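/- arXiv:1610.06387 — 13 statements merged into one kernel-verified Lean document; each statement's English description precedes it below -/
import Mathlib

section
/- Let ℓ be an even nonnegative integer. The number of 10-tuples (α11, α12, α13, α14, α22, α23, α24, α33, α34, α44) of nonnegative integers satisfying the system S(ℓ) equals (1/576)·(ℓ+2)·(ℓ+4)·(ℓ·(ℓ+5)·(ℓ·(ℓ+4)+12)+72). -/
/-- The Diophantine system S(ℓ): four equations in ten nonnegative integer unknowns. -/
def Ssol (ℓ : ℕ) : Set (ℕ × ℕ × ℕ × ℕ × ℕ × ℕ × ℕ × ℕ × ℕ × ℕ) :=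
  {p | match p with
       | (a11, a12, a13, a14, a22, a23, a24, a33, a34, a44) =>
         2*a11 + a12 + a13 + a14 = ℓ ∧
         a12 + 2*a22 + a23 + a24 = ℓ ∧
         a13 + a23 + 2*a33 + a34 = ℓ ∧
         a14 + a24 + a34 + 2*a44 = ℓ}

set_option linter.unusedSimpArgs false
set_option linter.unusedVariables false

lemma nc_bij {α β : Type*} {S : Set α} (f : β → α) (hf : Function.Injective f)
    (hc : ∀ s ∈ S, ∃ b, f b = s) (T : Set β) (hT : ∀ b, f b ∈ S ↔ b ∈ T) :
    S.ncard = T.ncard := by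
  have : S = f '' T := by
    ext s
    constructor
    · intro hs
      obtain ⟨b, rfl⟩ := hc s hs
      exact ⟨b, (hT b).1 hs, rfl⟩
    · rintro ⟨b, hb, rfl⟩
      exact (hT b).2 hb
  rw [this, Set.ncard_image_of_injective _ hf]

lemma nc_split {α β γ : Type*} {S : Set α} (hS : S.Finite) (f : β → α) (g : γ → α)
    (hf : Function.Injective f) (hg : Function.Injective g) (hd : ∀ b c, f b ≠ g c)
    (hc : ∀ s ∈ S, (∃ b, f b = s) ∨ ∃ c, g c = s)
    (T : Set β) (hT : ∀ b, f b ∈ S ↔ b ∈ T) (U : Set γ) (hU : ∀ b, g b ∈ S ↔ b ∈ U) :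
    S.ncard = T.ncard + U.ncard := by
  have h : S = f '' T ∪ g '' U := by
    ext s
    constructor
    · intro hs
      rcases hc s hs with ⟨b, rfl⟩ | ⟨b, rfl⟩
      · exact Or.inl ⟨b, (hT b).1 hs, rfl⟩
      · exact Or.inr ⟨b, (hU b).1 hs, rfl⟩
    · rintro (⟨b, hb, rfl⟩ | ⟨b, hb, rfl⟩)
      · exact (hT b).2 hb
      · exact (hU b).2 hb
  have h1 : (f '' T).Finite := hS.subset (by rw [h]; exact Set.subset_union_left)
  have h2 : (g '' U).Finite := hS.subset (by rw [h]; exact Set.subset_union_right)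
  rw [h, Set.ncard_union_eq _ h1 h2, Set.ncard_image_of_injective _ hf,
    Set.ncard_image_of_injective _ hg]
  rw [Set.disjoint_left]
  rintro _ ⟨b, _, rfl⟩ ⟨c, _, hc⟩
  exact hd b c hc.symm

abbrev N3 := ℕ × ℕ × ℕ
abbrev N6 := ℕ × ℕ × ℕ × ℕ × ℕ × ℕ

def T2 (n : ℕ) : Set (ℕ × ℕ) := {p | p.1 + p.2 < n}
def T3 (n : ℕ) : Set N3 := {p | p.1 + p.2.1 + p.2.2 < n}
def EE (n : ℕ) : Set N3 := {p | p.1 + p.2.1 < n ∧ p.1 + p.2.2 < n ∧ p.2.1 + p.2.2 < n}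
def WW (n : ℕ) : Set N3 := {p | p.1 + p.2.1 < n + 1 ∧ p.1 + p.2.2 < n ∧ p.2.1 + p.2.2 < n}

/-- vertex conditions; coordinates are (a12, a34, a13, a24, a14, a23) -/
def V (l a a' b b' c c' : ℕ) : Prop :=
  (a + b + c ≤ l ∧ (a + b + c) % 2 = l % 2) ∧ (a + b' + c' ≤ l ∧ (a + b' + c') % 2 = l % 2) ∧
  (a' + b + c' ≤ l ∧ (a' + b + c') % 2 = l % 2) ∧ (a' + b' + c ≤ l ∧ (a' + b' + c) % 2 = l % 2)

def S0 (l : ℕ) : Set N6 := {p | V l p.1 p.2.1 p.2.2.1 p.2.2.2.1 p.2.2.2.2.1 p.2.2.2.2.2}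
def S1 (l : ℕ) : Set N6 := {p | p ∈ S0 l ∧ (p.1 = 0 ∨ p.2.1 = 0)}
def S2 (l : ℕ) : Set N6 := {p | p ∈ S1 l ∧ (p.2.2.1 = 0 ∨ p.2.2.2.1 = 0)}
def S3 (l : ℕ) : Set N6 := {p | p ∈ S2 l ∧ (p.2.2.2.2.1 = 0 ∨ p.2.2.2.2.2 = 0)}

lemma fin2 {S : Set (ℕ × ℕ)} (n : ℕ) (h : ∀ p ∈ S, p.1 ≤ n ∧ p.2 ≤ n) : S.Finite :=
  (Set.finite_Iic ((n, n) : ℕ × ℕ)).subset fun p hp => ⟨(h p hp).1, (h p hp).2⟩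

lemma fin3 {S : Set N3} (n : ℕ) (h : ∀ p ∈ S, p.1 ≤ n ∧ p.2.1 ≤ n ∧ p.2.2 ≤ n) : S.Finite :=
  (Set.finite_Iic ((n, n, n) : N3)).subset fun p hp => ⟨(h p hp).1, (h p hp).2⟩

lemma S0_fin (l : ℕ) : (S0 l).Finite := by
  refine (Set.finite_Iic ((l, l, l, l, l, l) : N6)).subset ?_
  rintro ⟨a, a', b, b', c, c'⟩ h
  simp only [S0, V, Set.mem_ofPred_eq] at h
  simp only [Set.mem_Iic, Prod.mk_le_mk]
  omega
lemma S1_fin (l : ℕ) : (S1 l).Finite := (S0_fin l).subset fun _ h => h.1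
lemma S2_fin (l : ℕ) : (S2 l).Finite := (S1_fin l).subset fun _ h => h.1
lemma S3_fin (l : ℕ) : (S3 l).Finite := (S2_fin l).subset fun _ h => h.1

lemma T2_succ (n : ℕ) : (T2 (n + 1)).ncard = (T2 n).ncard + (n + 1) := by
  have : n + 1 = (Set.Iio (n + 1)).ncard := by
    rw [← Finset.coe_Iio, Set.ncard_coe_finset, Nat.card_Iio]
  conv_rhs => rw [this]
  refine nc_split (fin2 (n + 1) ?_) (fun p : ℕ × ℕ => (p.1 + 1, p.2)) (fun x : ℕ => (0, x))
    ?_ ?_ ?_ ?_ _ ?_ _ ?_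
  · rintro ⟨x, y⟩ h
    simp only [T2, Set.mem_ofPred_eq] at h ⊢
    omega
  · rintro ⟨x, y⟩ ⟨x', y'⟩ h
    simp only [Prod.mk.injEq] at h ⊢
    omega
  · intro x y h
    simpa using h
  · rintro ⟨x, y⟩ z
    simp
  · rintro ⟨_ | x, y⟩ h
    · exact Or.inr ⟨y, rfl⟩
    · exact Or.inl ⟨(x, y), rfl⟩
  · rintro ⟨x, y⟩
    simp only [T2, Set.mem_ofPred_eq]
    omega
  · intro x
    simp only [T2, Set.mem_ofPred_eq, Set.mem_Iio]
    omega

lemma T2_card (n : ℕ) : ((T2 n).ncard : ℚ) = n * (n + 1) / 2 := by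
  induction n with
  | zero => simp [T2]
  | succ n ih => rw [T2_succ]; push_cast; rw [ih]; ring

lemma T3_succ (n : ℕ) : (T3 (n + 1)).ncard = (T3 n).ncard + (T2 (n + 1)).ncard := by
  refine nc_split (fin3 (n + 1) ?_) (fun p : N3 => (p.1 + 1, p.2)) (fun x : ℕ × ℕ => (0, x))
    ?_ ?_ ?_ ?_ _ ?_ _ ?_
  · rintro ⟨x, y, z⟩ h
    simp only [T3, Set.mem_ofPred_eq] at h ⊢
    omega
  · rintro ⟨x, y⟩ ⟨x', y'⟩ h
    simp only [Prod.mk.injEq] at h ⊢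
    exact ⟨by omega, h.2⟩
  · intro x y h
    simpa using h
  · rintro ⟨x, y⟩ z
    simp
  · rintro ⟨_ | x, y⟩ h
    · exact Or.inr ⟨y, rfl⟩
    · exact Or.inl ⟨(x, y), rfl⟩
  · rintro ⟨x, y, z⟩
    simp only [T3, Set.mem_ofPred_eq]
    omega
  · rintro ⟨x, y⟩
    simp only [T3, T2, Set.mem_ofPred_eq]
    omega

lemma T3_card (n : ℕ) : ((T3 n).ncard : ℚ) = n * (n + 1) * (n + 2) / 6 := by
  induction n with
  | zero => simp [T3]
  | succ n ih => rw [T3_succ]; push_cast; rw [ih, T2_card]; push_cast; ring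

/-- `EE` splits off its `z = 0` face. -/
lemma EE_W (n : ℕ) : (EE (n + 1)).ncard = (WW n).ncard + (T2 (n + 1)).ncard := by
  refine nc_split (fin3 (n + 1) ?_) (fun p : N3 => (p.1, p.2.1, p.2.2 + 1))
    (fun x : ℕ × ℕ => (x.1, x.2, 0)) ?_ ?_ ?_ ?_ _ ?_ _ ?_
  · rintro ⟨x, y, z⟩ h
    simp only [EE, Set.mem_ofPred_eq] at h ⊢
    omega
  · rintro ⟨x, y, z⟩ ⟨x', y', z'⟩ h
    simp only [Prod.mk.injEq] at h ⊢
    omega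
  · rintro ⟨x, y⟩ ⟨x', y'⟩ h
    simp only [Prod.mk.injEq] at h ⊢
    omega
  · rintro ⟨x, y, z⟩ ⟨x', y'⟩
    simp
  · rintro ⟨x, y, _ | z⟩ h
    · exact Or.inr ⟨(x, y), rfl⟩
    · exact Or.inl ⟨(x, y, z), rfl⟩
  · rintro ⟨x, y, z⟩
    simp only [EE, WW, Set.mem_ofPred_eq]
    omega
  · rintro ⟨x, y⟩
    simp only [EE, T2, Set.mem_ofPred_eq]
    omega

/-- the part of `WW n` with `x ≥ 1` -/
def XX (n : ℕ) : Set N3 := {p | p.1 + p.2.1 < n ∧ p.1 + p.2.2 + 1 < n ∧ p.2.1 + p.2.2 < n}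

lemma WW_X (n : ℕ) : (WW n).ncard = (XX n).ncard + (T2 n).ncard := by
  refine nc_split (fin3 (n + 1) ?_) (fun p : N3 => (p.1 + 1, p.2.1, p.2.2))
    (fun x : ℕ × ℕ => (0, x.1, x.2)) ?_ ?_ ?_ ?_ _ ?_ _ ?_
  · rintro ⟨x, y, z⟩ h
    simp only [WW, Set.mem_ofPred_eq] at h ⊢
    omega
  · rintro ⟨x, y, z⟩ ⟨x', y', z'⟩ h
    simp only [Prod.mk.injEq] at h ⊢
    omega
  · rintro ⟨x, y⟩ ⟨x', y'⟩ h
    simp only [Prod.mk.injEq] at h ⊢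
    omega
  · rintro ⟨x, y, z⟩ ⟨x', y'⟩
    simp
  · rintro ⟨_ | x, y, z⟩ h
    · exact Or.inr ⟨(y, z), rfl⟩
    · exact Or.inl ⟨(x, y, z), rfl⟩
  · rintro ⟨x, y, z⟩
    simp only [XX, WW, Set.mem_ofPred_eq]
    omega
  · rintro ⟨x, y⟩
    simp only [WW, T2, Set.mem_ofPred_eq]
    omega

lemma XX_E (n : ℕ) : (XX n).ncard = (EE (n - 1)).ncard + (T2 (n - 1)).ncard := by
  refine nc_split (fin3 (n + 1) ?_) (fun p : N3 => (p.1, p.2.1 + 1, p.2.2))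
    (fun x : ℕ × ℕ => (x.1, 0, x.2)) ?_ ?_ ?_ ?_ _ ?_ _ ?_
  · rintro ⟨x, y, z⟩ h
    simp only [XX, Set.mem_ofPred_eq] at h ⊢
    omega
  · rintro ⟨x, y, z⟩ ⟨x', y', z'⟩ h
    simp only [Prod.mk.injEq] at h ⊢
    omega
  · rintro ⟨x, y⟩ ⟨x', y'⟩ h
    simp only [Prod.mk.injEq] at h ⊢
    omega
  · rintro ⟨x, y, z⟩ ⟨x', y'⟩
    simp
  · rintro ⟨x, _ | y, z⟩ h
    · exact Or.inr ⟨(x, z), rfl⟩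
    · exact Or.inl ⟨(x, y, z), rfl⟩
  · rintro ⟨x, y, z⟩
    simp only [XX, EE, Set.mem_ofPred_eq]
    omega
  · rintro ⟨x, y⟩
    simp only [XX, T2, Set.mem_ofPred_eq]
    omega

lemma EE_zero : (EE 0).ncard = 0 := by simp [EE]

lemma EE_rec (n : ℕ) : ((EE (n + 1)).ncard : ℚ) =
    (EE (n - 1)).ncard + (T2 (n - 1)).ncard + (T2 n).ncard + (T2 (n + 1)).ncard := by
  rw [EE_W, WW_X, XX_E]; push_cast; ring

lemma EE_one : ((EE 1).ncard : ℚ) = 1 := by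
  have h := EE_rec 0
  rw [Nat.zero_sub, zero_add, EE_zero, T2_card, T2_card] at h
  rw [h]
  norm_num

lemma EE_pair (n : ℕ) : ((EE (n + 1)).ncard : ℚ) + (EE n).ncard =
    1 + 2 * n + (3/2) * n ^ 2 + (1/2) * n ^ 3 := by
  induction n with
  | zero =>
    rw [zero_add, EE_one, EE_zero]
    norm_num
  | succ n ih =>
    have := EE_rec (n + 1)
    simp only [T2_card, Nat.add_sub_cancel] at this
    push_cast at this ⊢
    linarith

lemma oct_split {S : Set N6} (hS : S.Finite)
    (h : ∀ p ∈ S, (p.1 = 0 ∨ p.2.1 = 0) ∧ (p.2.2.1 = 0 ∨ p.2.2.2.1 = 0) ∧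
      (p.2.2.2.2.1 = 0 ∨ p.2.2.2.2.2 = 0)) :
    S.ncard =
      (({p : N3 | ((p.1, 0, p.2.1, 0, p.2.2, 0) : N6) ∈ S}.ncard +
      {p : N3 | ((p.1, 0, p.2.1, 0, 0, p.2.2 + 1) : N6) ∈ S}.ncard) +
      ({p : N3 | ((p.1, 0, 0, p.2.1 + 1, p.2.2, 0) : N6) ∈ S}.ncard +
      {p : N3 | ((p.1, 0, 0, p.2.1 + 1, 0, p.2.2 + 1) : N6) ∈ S}.ncard)) +
      (({p : N3 | ((0, p.1 + 1, p.2.1, 0, p.2.2, 0) : N6) ∈ S}.ncard +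
      {p : N3 | ((0, p.1 + 1, p.2.1, 0, 0, p.2.2 + 1) : N6) ∈ S}.ncard) +
      ({p : N3 | ((0, p.1 + 1, 0, p.2.1 + 1, p.2.2, 0) : N6) ∈ S}.ncard +
      {p : N3 | ((0, p.1 + 1, 0, p.2.1 + 1, 0, p.2.2 + 1) : N6) ∈ S}.ncard)) := by
  have A : S.ncard = {p : ℕ × ℕ × ℕ × ℕ × ℕ | ((p.1, 0, p.2) : N6) ∈ S}.ncard +
      {p : ℕ × ℕ × ℕ × ℕ × ℕ | ((0, p.1 + 1, p.2) : N6) ∈ S}.ncard := by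
    refine nc_split hS (fun p : ℕ × ℕ × ℕ × ℕ × ℕ => ((p.1, 0, p.2) : N6))
      (fun p : ℕ × ℕ × ℕ × ℕ × ℕ => ((0, p.1 + 1, p.2) : N6)) ?_ ?_ ?_ ?_ _ ?_ _ ?_
    · rintro ⟨x, y⟩ ⟨x', y'⟩ h
      simpa using h
    · rintro ⟨x, y⟩ ⟨x', y'⟩ h
      simpa using h
    · rintro ⟨x, y⟩ ⟨x', y'⟩
      simp
    · rintro ⟨x, y, r⟩ hs
      rcases y with _ | y
      · exact Or.inl ⟨(x, r), rfl⟩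
      · obtain rfl : x = 0 := by
          have := (h _ hs).1
          simp at this
          omega
        exact Or.inr ⟨(y, r), rfl⟩
    · exact fun _ => Iff.rfl
    · exact fun _ => Iff.rfl
  have B : ∀ S : Set (ℕ × ℕ × ℕ × ℕ × ℕ), S.Finite → (∀ p ∈ S, p.2.1 = 0 ∨ p.2.2.1 = 0) →
      S.ncard = {p : ℕ × ℕ × ℕ × ℕ | (p.1, p.2.1, 0, p.2.2) ∈ S}.ncard +
      {p : ℕ × ℕ × ℕ × ℕ | (p.1, 0, p.2.1 + 1, p.2.2) ∈ S}.ncard := by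
    intro S hS h
    refine nc_split hS (fun p : ℕ × ℕ × ℕ × ℕ => (p.1, p.2.1, 0, p.2.2))
      (fun p : ℕ × ℕ × ℕ × ℕ => (p.1, 0, p.2.1 + 1, p.2.2)) ?_ ?_ ?_ ?_ _ ?_ _ ?_
    · rintro ⟨w, x, y⟩ ⟨w', x', y'⟩ h
      simpa using h
    · rintro ⟨w, x, y⟩ ⟨w', x', y'⟩ h
      simpa using h
    · rintro ⟨w, x, y⟩ ⟨w', x', y'⟩
      simp
    · rintro ⟨w, x, y, r⟩ hs
      rcases y with _ | y
      · exact Or.inl ⟨(w, x, r), rfl⟩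
      · obtain rfl : x = 0 := by
          have := h _ hs
          simp at this
          omega
        exact Or.inr ⟨(w, y, r), rfl⟩
    · exact fun _ => Iff.rfl
    · exact fun _ => Iff.rfl
  have D : ∀ S : Set (ℕ × ℕ × ℕ × ℕ), S.Finite → (∀ p ∈ S, p.2.2.1 = 0 ∨ p.2.2.2 = 0) →
      S.ncard = {p : ℕ × ℕ × ℕ | (p.1, p.2.1, p.2.2, 0) ∈ S}.ncard +
      {p : ℕ × ℕ × ℕ | (p.1, p.2.1, 0, p.2.2 + 1) ∈ S}.ncard := by
    intro S hS h
    refine nc_split hS (fun p : ℕ × ℕ × ℕ => (p.1, p.2.1, p.2.2, 0))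
      (fun p : ℕ × ℕ × ℕ => (p.1, p.2.1, 0, p.2.2 + 1)) ?_ ?_ ?_ ?_ _ ?_ _ ?_
    · rintro ⟨w, x, y⟩ ⟨w', x', y'⟩ h
      simpa using h
    · rintro ⟨w, x, y⟩ ⟨w', x', y'⟩ h
      simpa using h
    · rintro ⟨w, x, y⟩ ⟨w', x', y'⟩
      simp
    · rintro ⟨w, u, x, y⟩ hs
      rcases y with _ | y
      · exact Or.inl ⟨(w, u, x), rfl⟩
      · obtain rfl : x = 0 := by
          have := h _ hs
          simp at this
          omega
        exact Or.inr ⟨(w, u, y), rfl⟩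
    · exact fun _ => Iff.rfl
    · exact fun _ => Iff.rfl
  have i1 : Function.Injective (fun p : ℕ × ℕ × ℕ × ℕ × ℕ => ((p.1, 0, p.2) : N6)) := by
    rintro ⟨x, y⟩ ⟨x', y'⟩ h
    simpa using h
  have i2 : Function.Injective (fun p : ℕ × ℕ × ℕ × ℕ × ℕ => ((0, p.1 + 1, p.2) : N6)) := by
    rintro ⟨x, y⟩ ⟨x', y'⟩ h
    simpa using h
  have j1 : Function.Injective (fun p : ℕ × ℕ × ℕ × ℕ => (p.1, p.2.1, 0, p.2.2)) := by
    rintro ⟨w, x, y⟩ ⟨w', x', y'⟩ h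
    simpa using h
  have j2 : Function.Injective (fun p : ℕ × ℕ × ℕ × ℕ => (p.1, 0, p.2.1 + 1, p.2.2)) := by
    rintro ⟨w, x, y⟩ ⟨w', x', y'⟩ h
    simpa using h
  have f1 : {p : ℕ × ℕ × ℕ × ℕ × ℕ | ((p.1, 0, p.2) : N6) ∈ S}.Finite := hS.preimage i1.injOn
  have f2 : {p : ℕ × ℕ × ℕ × ℕ × ℕ | ((0, p.1 + 1, p.2) : N6) ∈ S}.Finite := hS.preimage i2.injOn
  have c1 := B _ f1 fun p hp => (h _ hp).2.1
  have c2 := B _ f2 fun p hp => (h _ hp).2.1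
  have d1 := D _ (f1.preimage j1.injOn) fun p hp => (h _ hp).2.2
  have d2 := D _ (f1.preimage j2.injOn) fun p hp => (h _ hp).2.2
  have d3 := D _ (f2.preimage j1.injOn) fun p hp => (h _ hp).2.2
  have d4 := D _ (f2.preimage j2.injOn) fun p hp => (h _ hp).2.2
  exact A.trans (congrArg₂ (· + ·) (c1.trans (congrArg₂ (· + ·) d1 d2))
    (c2.trans (congrArg₂ (· + ·) d3 d4)))

lemma S3_oct (l : ℕ) (p : N6) (hp : p ∈ S3 l) : (p.1 = 0 ∨ p.2.1 = 0) ∧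
    (p.2.2.1 = 0 ∨ p.2.2.2.1 = 0) ∧ (p.2.2.2.2.1 = 0 ∨ p.2.2.2.2.2 = 0) :=
  ⟨hp.1.1.2, hp.1.2, hp.2⟩

/-- A set of triples on one parity class each, rescaled. -/
lemma nc_half {S : Set N3} (i j k : ℕ) (hi : i < 2) (hj : j < 2) (hk : k < 2)
    (h : ∀ x y z, (x, y, z) ∈ S → x % 2 = i ∧ y % 2 = j ∧ z % 2 = k) (T : Set N3)
    (hT : ∀ x y z, (2 * x + i, 2 * y + j, 2 * z + k) ∈ S ↔ (x, y, z) ∈ T) :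
    S.ncard = T.ncard := by
  refine nc_bij (fun p : N3 => (2 * p.1 + i, 2 * p.2.1 + j, 2 * p.2.2 + k)) ?_ ?_ T ?_
  · rintro ⟨x, y, z⟩ ⟨x', y', z'⟩ h
    simp only [Prod.mk.injEq] at h ⊢
    omega
  · rintro ⟨x, y, z⟩ hs
    have := h x y z hs
    refine ⟨(x / 2, y / 2, z / 2), ?_⟩
    simp only [Prod.mk.injEq]
    omega
  · rintro ⟨x, y, z⟩
    exact hT x y z

/-- A set of triples on two opposite parity classes, rescaled. -/
lemma nc_half2 {S : Set N3} (hS : S.Finite) (i j k : ℕ) (hi : i < 2) (hj : j < 2) (hk : k < 2)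
    (h : ∀ x y z, (x, y, z) ∈ S → (x % 2 = i ∧ y % 2 = j ∧ z % 2 = k) ∨
      (x % 2 = 1 - i ∧ y % 2 = 1 - j ∧ z % 2 = 1 - k)) (T U : Set N3)
    (hT : ∀ x y z, (2 * x + i, 2 * y + j, 2 * z + k) ∈ S ↔ (x, y, z) ∈ T)
    (hU : ∀ x y z, (2 * x + (1 - i), 2 * y + (1 - j), 2 * z + (1 - k)) ∈ S ↔ (x, y, z) ∈ U) :
    S.ncard = T.ncard + U.ncard := by
  refine nc_split hS (fun p : N3 => (2 * p.1 + i, 2 * p.2.1 + j, 2 * p.2.2 + k))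
    (fun p : N3 => (2 * p.1 + (1 - i), 2 * p.2.1 + (1 - j), 2 * p.2.2 + (1 - k)))
    ?_ ?_ ?_ ?_ T ?_ U ?_
  · rintro ⟨x, y, z⟩ ⟨x', y', z'⟩ h
    simp only [Prod.mk.injEq] at h ⊢
    omega
  · rintro ⟨x, y, z⟩ ⟨x', y', z'⟩ h
    simp only [Prod.mk.injEq] at h ⊢
    omega
  · rintro ⟨x, y, z⟩ ⟨x', y', z'⟩ h
    simp only [Prod.mk.injEq] at h
    omega
  · rintro ⟨x, y, z⟩ hs
    rcases h x y z hs with h | h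
    · refine Or.inl ⟨(x / 2, y / 2, z / 2), ?_⟩
      simp only [Prod.mk.injEq]
      omega
    · refine Or.inr ⟨(x / 2, y / 2, z / 2), ?_⟩
      simp only [Prod.mk.injEq]
      omega
  · rintro ⟨x, y, z⟩
    exact hT x y z
  · rintro ⟨x, y, z⟩
    exact hU x y z

lemma WW_perm1 (n : ℕ) :
    {p : N3 | p.1 + p.2.2 < n + 1 ∧ p.1 + p.2.1 < n ∧ p.2.1 + p.2.2 < n}.ncard = (WW n).ncard := by
  refine nc_bij (fun p : N3 => (p.1, p.2.2, p.2.1)) ?_ ?_ _ ?_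
  · rintro ⟨x, y, z⟩ ⟨x', y', z'⟩ h
    simp only [Prod.mk.injEq] at h ⊢
    omega
  · rintro ⟨x, y, z⟩ _
    exact ⟨(x, z, y), rfl⟩
  · rintro ⟨x, y, z⟩
    simp only [WW, Set.mem_ofPred_eq]
    omega

lemma WW_perm2 (n : ℕ) :
    {p : N3 | p.2.1 + p.2.2 < n + 1 ∧ p.1 + p.2.1 < n ∧ p.1 + p.2.2 < n}.ncard = (WW n).ncard := by
  refine nc_bij (fun p : N3 => (p.2.2, p.2.1, p.1)) ?_ ?_ _ ?_
  · rintro ⟨x, y, z⟩ ⟨x', y', z'⟩ h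
    simp only [Prod.mk.injEq] at h ⊢
    omega
  · rintro ⟨x, y, z⟩ _
    exact ⟨(z, y, x), rfl⟩
  · rintro ⟨x, y, z⟩
    simp only [WW, Set.mem_ofPred_eq]
    omega

lemma S3_odd (m : ℕ) : (S3 (2 * m + 1)).ncard = 4 * (T3 m).ncard := by
  rw [oct_split (S3_fin _) (S3_oct _)]
  have h000 : {p : N3 | ((p.1, 0, p.2.1, 0, p.2.2, 0) : N6) ∈ S3 (2 * m + 1)}.ncard = (T3 m).ncard := by
    refine nc_half 1 1 1 (by norm_num) (by norm_num) (by norm_num) ?_ _ ?_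
    all_goals
      intro x y z
      simp only [S3, S2, S1, S0, V, T3, EE, WW, Set.mem_ofPred_eq, true_or, or_true, and_true, true_and]
      omega
  have h001 : {p : N3 | ((p.1, 0, p.2.1, 0, 0, p.2.2 + 1) : N6) ∈ S3 (2 * m + 1)}.ncard = 0 := by
    convert Set.ncard_empty N3
    rw [Set.eq_empty_iff_forall_notMem]
    rintro ⟨x, y, z⟩
    simp only [S3, S2, S1, S0, V, T3, EE, WW, Set.mem_ofPred_eq, true_or, or_true, and_true, true_and]
    omega
  have h010 : {p : N3 | ((p.1, 0, 0, p.2.1 + 1, p.2.2, 0) : N6) ∈ S3 (2 * m + 1)}.ncard = 0 := by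
    convert Set.ncard_empty N3
    rw [Set.eq_empty_iff_forall_notMem]
    rintro ⟨x, y, z⟩
    simp only [S3, S2, S1, S0, V, T3, EE, WW, Set.mem_ofPred_eq, true_or, or_true, and_true, true_and]
    omega
  have h011 : {p : N3 | ((p.1, 0, 0, p.2.1 + 1, 0, p.2.2 + 1) : N6) ∈ S3 (2 * m + 1)}.ncard = (T3 m).ncard := by
    refine nc_half 1 0 0 (by norm_num) (by norm_num) (by norm_num) ?_ _ ?_
    all_goals
      intro x y z
      simp only [S3, S2, S1, S0, V, T3, EE, WW, Set.mem_ofPred_eq, true_or, or_true, and_true, true_and]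
      omega
  have h100 : {p : N3 | ((0, p.1 + 1, p.2.1, 0, p.2.2, 0) : N6) ∈ S3 (2 * m + 1)}.ncard = 0 := by
    convert Set.ncard_empty N3
    rw [Set.eq_empty_iff_forall_notMem]
    rintro ⟨x, y, z⟩
    simp only [S3, S2, S1, S0, V, T3, EE, WW, Set.mem_ofPred_eq, true_or, or_true, and_true, true_and]
    omega
  have h101 : {p : N3 | ((0, p.1 + 1, p.2.1, 0, 0, p.2.2 + 1) : N6) ∈ S3 (2 * m + 1)}.ncard = (T3 m).ncard := by
    refine nc_half 0 1 0 (by norm_num) (by norm_num) (by norm_num) ?_ _ ?_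
    all_goals
      intro x y z
      simp only [S3, S2, S1, S0, V, T3, EE, WW, Set.mem_ofPred_eq, true_or, or_true, and_true, true_and]
      omega
  have h110 : {p : N3 | ((0, p.1 + 1, 0, p.2.1 + 1, p.2.2, 0) : N6) ∈ S3 (2 * m + 1)}.ncard = (T3 m).ncard := by
    refine nc_half 0 0 1 (by norm_num) (by norm_num) (by norm_num) ?_ _ ?_
    all_goals
      intro x y z
      simp only [S3, S2, S1, S0, V, T3, EE, WW, Set.mem_ofPred_eq, true_or, or_true, and_true, true_and]
      omega
  have h111 : {p : N3 | ((0, p.1 + 1, 0, p.2.1 + 1, 0, p.2.2 + 1) : N6) ∈ S3 (2 * m + 1)}.ncard = 0 := by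
    convert Set.ncard_empty N3
    rw [Set.eq_empty_iff_forall_notMem]
    rintro ⟨x, y, z⟩
    simp only [S3, S2, S1, S0, V, T3, EE, WW, Set.mem_ofPred_eq, true_or, or_true, and_true, true_and]
    omega
  rw [h000, h001, h010, h011, h100, h101, h110, h111]
  ring

lemma S3_even (m : ℕ) : (S3 (2 * m)).ncard = (T3 (m + 1)).ncard + 3 * (T3 (m - 1)).ncard +
    3 * (WW m).ncard + 4 * (EE m).ncard + (EE (m - 1)).ncard := by
  rw [oct_split (S3_fin _) (S3_oct _)]
  have h000 : {p : N3 | ((p.1, 0, p.2.1, 0, p.2.2, 0) : N6) ∈ S3 (2 * m)}.ncard = (T3 (m + 1)).ncard := by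
    refine nc_half 0 0 0 (by norm_num) (by norm_num) (by norm_num) ?_ _ ?_
    all_goals
      intro x y z
      simp only [S3, S2, S1, S0, V, T3, EE, WW, Set.mem_ofPred_eq, true_or, or_true, and_true, true_and]
      omega
  have h001 : {p : N3 | ((p.1, 0, p.2.1, 0, 0, p.2.2 + 1) : N6) ∈ S3 (2 * m)}.ncard = (WW m).ncard + (EE m).ncard := by
    refine nc_half2 (fin3 (2 * m) ?_) 0 0 1 (by norm_num) (by norm_num) (by norm_num) ?_ _ _ ?_ ?_
    · rintro ⟨x, y, z⟩
      simp only [S3, S2, S1, S0, V, T3, EE, WW, Set.mem_ofPred_eq, true_or, or_true, and_true, true_and]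
      omega
    all_goals
      intro x y z
      simp only [S3, S2, S1, S0, V, T3, EE, WW, Set.mem_ofPred_eq, true_or, or_true, and_true, true_and]
      omega
  have h010 : {p : N3 | ((p.1, 0, 0, p.2.1 + 1, p.2.2, 0) : N6) ∈ S3 (2 * m)}.ncard = (WW m).ncard + (EE m).ncard := by
    rw [← WW_perm1]
    refine nc_half2 (fin3 (2 * m) ?_) 0 1 0 (by norm_num) (by norm_num) (by norm_num) ?_ _ _ ?_ ?_
    · rintro ⟨x, y, z⟩
      simp only [S3, S2, S1, S0, V, T3, EE, WW, Set.mem_ofPred_eq, true_or, or_true, and_true, true_and]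
      omega
    all_goals
      intro x y z
      simp only [S3, S2, S1, S0, V, T3, EE, WW, Set.mem_ofPred_eq, true_or, or_true, and_true, true_and]
      omega
  have h011 : {p : N3 | ((p.1, 0, 0, p.2.1 + 1, 0, p.2.2 + 1) : N6) ∈ S3 (2 * m)}.ncard = (T3 (m - 1)).ncard := by
    refine nc_half 0 1 1 (by norm_num) (by norm_num) (by norm_num) ?_ _ ?_
    all_goals
      intro x y z
      simp only [S3, S2, S1, S0, V, T3, EE, WW, Set.mem_ofPred_eq, true_or, or_true, and_true, true_and]
      omega
  have h100 : {p : N3 | ((0, p.1 + 1, p.2.1, 0, p.2.2, 0) : N6) ∈ S3 (2 * m)}.ncard = (WW m).ncard + (EE m).ncard := by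
    rw [← WW_perm2]
    refine nc_half2 (fin3 (2 * m) ?_) 1 0 0 (by norm_num) (by norm_num) (by norm_num) ?_ _ _ ?_ ?_
    · rintro ⟨x, y, z⟩
      simp only [S3, S2, S1, S0, V, T3, EE, WW, Set.mem_ofPred_eq, true_or, or_true, and_true, true_and]
      omega
    all_goals
      intro x y z
      simp only [S3, S2, S1, S0, V, T3, EE, WW, Set.mem_ofPred_eq, true_or, or_true, and_true, true_and]
      omega
  have h101 : {p : N3 | ((0, p.1 + 1, p.2.1, 0, 0, p.2.2 + 1) : N6) ∈ S3 (2 * m)}.ncard = (T3 (m - 1)).ncard := by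
    refine nc_half 1 0 1 (by norm_num) (by norm_num) (by norm_num) ?_ _ ?_
    all_goals
      intro x y z
      simp only [S3, S2, S1, S0, V, T3, EE, WW, Set.mem_ofPred_eq, true_or, or_true, and_true, true_and]
      omega
  have h110 : {p : N3 | ((0, p.1 + 1, 0, p.2.1 + 1, p.2.2, 0) : N6) ∈ S3 (2 * m)}.ncard = (T3 (m - 1)).ncard := by
    refine nc_half 1 1 0 (by norm_num) (by norm_num) (by norm_num) ?_ _ ?_
    all_goals
      intro x y z
      simp only [S3, S2, S1, S0, V, T3, EE, WW, Set.mem_ofPred_eq, true_or, or_true, and_true, true_and]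
      omega
  have h111 : {p : N3 | ((0, p.1 + 1, 0, p.2.1 + 1, 0, p.2.2 + 1) : N6) ∈ S3 (2 * m)}.ncard = (EE (m - 1)).ncard + (EE m).ncard := by
    refine nc_half2 (fin3 (2 * m) ?_) 1 1 1 (by norm_num) (by norm_num) (by norm_num) ?_ _ _ ?_ ?_
    · rintro ⟨x, y, z⟩
      simp only [S3, S2, S1, S0, V, T3, EE, WW, Set.mem_ofPred_eq, true_or, or_true, and_true, true_and]
      omega
    all_goals
      intro x y z
      simp only [S3, S2, S1, S0, V, T3, EE, WW, Set.mem_ofPred_eq, true_or, or_true, and_true, true_and]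
      omega
  rw [h000, h001, h010, h011, h100, h101, h110, h111]
  ring

lemma S3_odd_card (m : ℕ) : ((S3 (2 * m + 1)).ncard : ℚ) =
    (4/3) * m + 2 * m ^ 2 + (2/3) * m ^ 3 := by
  rw [S3_odd]; push_cast; rw [T3_card]; ring

lemma S3_even_card (m : ℕ) : ((S3 (2 * m)).ncard : ℚ) =
    1 + (10/3) * m + 4 * m ^ 2 + (8/3) * m ^ 3 := by
  have h1 := EE_pair m
  have h2 := EE_W m
  have h3 := EE_rec m
  rw [S3_even]
  have h2' : ((EE (m + 1)).ncard : ℚ) = (WW m).ncard + (T2 (m + 1)).ncard := by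
    exact_mod_cast h2
  rcases m with _ | m
  · rw [zero_add, EE_one, T2_card] at h2'
    rw [Nat.zero_sub, EE_zero]
    push_cast
    rw [T3_card, T3_card]
    norm_num at h2' ⊢
    simp [h2']
  · simp only [T2_card, T3_card, Nat.add_sub_cancel] at *
    push_cast at *
    simp only [T2_card, T3_card] at *
    push_cast at *
    linarith

lemma S2_rec (l : ℕ) : (S2 (l + 1)).ncard = (S2 l).ncard + (S3 (l + 1)).ncard := by
  have key : {p : N6 | p ∈ S2 (l + 1) ∧ (p.2.2.2.2.1 ≠ 0 ∧ p.2.2.2.2.2 ≠ 0)}.ncard = (S2 l).ncard := by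
    refine nc_bij (fun p : N6 => ((p.1, p.2.1, p.2.2.1, p.2.2.2.1, p.2.2.2.2.1 + 1, p.2.2.2.2.2 + 1) : N6)) ?_ ?_ _ ?_
    · rintro ⟨a, a', b, b', c, c'⟩ ⟨x, x', y, y', z, z'⟩ h
      simp only [Prod.mk.injEq] at h ⊢
      omega
    · rintro ⟨a, a', b, b', c, c'⟩ ⟨_, h1, h2⟩
      refine ⟨(a, a', b, b', c - 1, c' - 1), ?_⟩
      simp only [Prod.mk.injEq, true_and, and_true]
      simp only at h1 h2
      omega
    · rintro ⟨a, a', b, b', c, c'⟩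
      simp only [S2, S1, S0, V, Set.mem_ofPred_eq]
      omega
  rw [← key, add_comm (Set.ncard _)]
  have hu : S2 (l + 1) = S3 (l + 1) ∪ {p : N6 | p ∈ S2 (l + 1) ∧ (p.2.2.2.2.1 ≠ 0 ∧ p.2.2.2.2.2 ≠ 0)} := by
    ext p
    simp only [S3, Set.mem_union, Set.mem_ofPred_eq]
    tauto
  conv_lhs => rw [hu]
  refine Set.ncard_union_eq ?_ (S3_fin _) ((S2_fin _).subset fun _ h => h.1)
  rw [Set.disjoint_left]
  rintro p hp ⟨_, h1, h2⟩
  rcases hp.2 with h | h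
  · exact h1 h
  · exact h2 h

lemma S2_zero : (S2 0).ncard = 1 := by
  rw [Set.ncard_eq_one]
  refine ⟨(0, 0, 0, 0, 0, 0), ?_⟩
  ext ⟨a, a', b, b', c, c'⟩
  simp only [S2, S1, S0, V, Set.mem_ofPred_eq, Set.mem_singleton_iff, Prod.mk.injEq]
  omega

lemma S2_card (m : ℕ) : ((S2 (2 * m)).ncard : ℚ) =
    (1) + (3)*(m:ℚ)^1 + (25/6)*(m:ℚ)^2 + (3)*(m:ℚ)^3 + (5/6)*(m:ℚ)^4 ∧
    ((S2 (2 * m + 1)).ncard : ℚ) =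
    (1) + (13/3)*(m:ℚ)^1 + (37/6)*(m:ℚ)^2 + (11/3)*(m:ℚ)^3 + (5/6)*(m:ℚ)^4 := by
  have step : ∀ k : ℕ, ((S2 (2 * k)).ncard : ℚ) =
    (1) + (3)*(k:ℚ)^1 + (25/6)*(k:ℚ)^2 + (3)*(k:ℚ)^3 + (5/6)*(k:ℚ)^4 →
    ((S2 (2 * k + 1)).ncard : ℚ) =
    (1) + (13/3)*(k:ℚ)^1 + (37/6)*(k:ℚ)^2 + (11/3)*(k:ℚ)^3 + (5/6)*(k:ℚ)^4 := by
    intro k hk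
    rw [S2_rec]
    push_cast
    rw [hk, S3_odd_card k]
    ring
  induction m with
  | zero =>
    have h0 : ((S2 (2 * 0)).ncard : ℚ) =
    (1) + (3)*((0 : ℕ) : ℚ)^1 + (25/6)*((0 : ℕ) : ℚ)^2 + (3)*((0 : ℕ) : ℚ)^3 + (5/6)*((0 : ℕ) : ℚ)^4 := by
      rw [mul_zero, S2_zero]
      norm_num
    exact ⟨h0, step 0 h0⟩
  | succ m ih =>
    have h1 : ((S2 (2 * (m + 1))).ncard : ℚ) =
    (1) + (3)*((m + 1 : ℕ) : ℚ)^1 + (25/6)*((m + 1 : ℕ) : ℚ)^2 + (3)*((m + 1 : ℕ) : ℚ)^3 + (5/6)*((m + 1 : ℕ) : ℚ)^4 := by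
      have e := S3_even_card (m + 1)
      rw [show 2 * (m + 1) = 2 * m + 1 + 1 by ring] at e ⊢
      rw [S2_rec]
      push_cast at e ⊢
      rw [ih.2, e]
      ring
    exact ⟨h1, step _ h1⟩

lemma S1_rec (l : ℕ) : (S1 (l + 1)).ncard = (S1 l).ncard + (S2 (l + 1)).ncard := by
  have key : {p : N6 | p ∈ S1 (l + 1) ∧ (p.2.2.1 ≠ 0 ∧ p.2.2.2.1 ≠ 0)}.ncard = (S1 l).ncard := by
    refine nc_bij (fun p : N6 => ((p.1, p.2.1, p.2.2.1 + 1, p.2.2.2.1 + 1, p.2.2.2.2.1, p.2.2.2.2.2) : N6)) ?_ ?_ _ ?_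
    · rintro ⟨a, a', b, b', c, c'⟩ ⟨x, x', y, y', z, z'⟩ h
      simp only [Prod.mk.injEq] at h ⊢
      omega
    · rintro ⟨a, a', b, b', c, c'⟩ ⟨_, h1, h2⟩
      refine ⟨(a, a', b - 1, b' - 1, c, c'), ?_⟩
      simp only [Prod.mk.injEq, true_and, and_true]
      simp only at h1 h2
      omega
    · rintro ⟨a, a', b, b', c, c'⟩
      simp only [S2, S1, S0, V, Set.mem_ofPred_eq]
      omega
  rw [← key, add_comm (Set.ncard _)]
  have hu : S1 (l + 1) = S2 (l + 1) ∪ {p : N6 | p ∈ S1 (l + 1) ∧ (p.2.2.1 ≠ 0 ∧ p.2.2.2.1 ≠ 0)} := by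
    ext p
    simp only [S2, Set.mem_union, Set.mem_ofPred_eq]
    tauto
  conv_lhs => rw [hu]
  refine Set.ncard_union_eq ?_ (S2_fin _) ((S1_fin _).subset fun _ h => h.1)
  rw [Set.disjoint_left]
  rintro p hp ⟨_, h1, h2⟩
  rcases hp.2 with h | h
  · exact h1 h
  · exact h2 h

lemma S1_zero : (S1 0).ncard = 1 := by
  rw [Set.ncard_eq_one]
  refine ⟨(0, 0, 0, 0, 0, 0), ?_⟩
  ext ⟨a, a', b, b', c, c'⟩
  simp only [S2, S1, S0, V, Set.mem_ofPred_eq, Set.mem_singleton_iff, Prod.mk.injEq]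
  omega

lemma S1_card (m : ℕ) : ((S1 (2 * m)).ncard : ℚ) =
    (1) + (3)*(m:ℚ)^1 + (13/3)*(m:ℚ)^2 + (11/3)*(m:ℚ)^3 + (5/3)*(m:ℚ)^4 + (1/3)*(m:ℚ)^5 ∧
    ((S1 (2 * m + 1)).ncard : ℚ) =
    (2) + (22/3)*(m:ℚ)^1 + (21/2)*(m:ℚ)^2 + (22/3)*(m:ℚ)^3 + (5/2)*(m:ℚ)^4 + (1/3)*(m:ℚ)^5 := by
  have step : ∀ k : ℕ, ((S1 (2 * k)).ncard : ℚ) =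
    (1) + (3)*(k:ℚ)^1 + (13/3)*(k:ℚ)^2 + (11/3)*(k:ℚ)^3 + (5/3)*(k:ℚ)^4 + (1/3)*(k:ℚ)^5 →
    ((S1 (2 * k + 1)).ncard : ℚ) =
    (2) + (22/3)*(k:ℚ)^1 + (21/2)*(k:ℚ)^2 + (22/3)*(k:ℚ)^3 + (5/2)*(k:ℚ)^4 + (1/3)*(k:ℚ)^5 := by
    intro k hk
    rw [S1_rec]
    push_cast
    rw [hk, (S2_card k).2]
    ring
  induction m with
  | zero =>
    have h0 : ((S1 (2 * 0)).ncard : ℚ) =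
    (1) + (3)*((0 : ℕ) : ℚ)^1 + (13/3)*((0 : ℕ) : ℚ)^2 + (11/3)*((0 : ℕ) : ℚ)^3 + (5/3)*((0 : ℕ) : ℚ)^4 + (1/3)*((0 : ℕ) : ℚ)^5 := by
      rw [mul_zero, S1_zero]
      norm_num
    exact ⟨h0, step 0 h0⟩
  | succ m ih =>
    have h1 : ((S1 (2 * (m + 1))).ncard : ℚ) =
    (1) + (3)*((m + 1 : ℕ) : ℚ)^1 + (13/3)*((m + 1 : ℕ) : ℚ)^2 + (11/3)*((m + 1 : ℕ) : ℚ)^3 + (5/3)*((m + 1 : ℕ) : ℚ)^4 + (1/3)*((m + 1 : ℕ) : ℚ)^5 := by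
      have e := (S2_card (m + 1)).1
      rw [show 2 * (m + 1) = 2 * m + 1 + 1 by ring] at e ⊢
      rw [S1_rec]
      push_cast at e ⊢
      rw [ih.2, e]
      ring
    exact ⟨h1, step _ h1⟩

lemma S0_rec (l : ℕ) : (S0 (l + 1)).ncard = (S0 l).ncard + (S1 (l + 1)).ncard := by
  have key : {p : N6 | p ∈ S0 (l + 1) ∧ (p.1 ≠ 0 ∧ p.2.1 ≠ 0)}.ncard = (S0 l).ncard := by
    refine nc_bij (fun p : N6 => ((p.1 + 1, p.2.1 + 1, p.2.2.1, p.2.2.2.1, p.2.2.2.2.1, p.2.2.2.2.2) : N6)) ?_ ?_ _ ?_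
    · rintro ⟨a, a', b, b', c, c'⟩ ⟨x, x', y, y', z, z'⟩ h
      simp only [Prod.mk.injEq] at h ⊢
      omega
    · rintro ⟨a, a', b, b', c, c'⟩ ⟨_, h1, h2⟩
      refine ⟨(a - 1, a' - 1, b, b', c, c'), ?_⟩
      simp only [Prod.mk.injEq, true_and, and_true]
      simp only at h1 h2
      omega
    · rintro ⟨a, a', b, b', c, c'⟩
      simp only [S2, S1, S0, V, Set.mem_ofPred_eq]
      omega
  rw [← key, add_comm (Set.ncard _)]
  have hu : S0 (l + 1) = S1 (l + 1) ∪ {p : N6 | p ∈ S0 (l + 1) ∧ (p.1 ≠ 0 ∧ p.2.1 ≠ 0)} := by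
    ext p
    simp only [S1, Set.mem_union, Set.mem_ofPred_eq]
    tauto
  conv_lhs => rw [hu]
  refine Set.ncard_union_eq ?_ (S1_fin _) ((S0_fin _).subset fun _ h => h.1)
  rw [Set.disjoint_left]
  rintro p hp ⟨_, h1, h2⟩
  rcases hp.2 with h | h
  · exact h1 h
  · exact h2 h

lemma S0_zero : (S0 0).ncard = 1 := by
  rw [Set.ncard_eq_one]
  refine ⟨(0, 0, 0, 0, 0, 0), ?_⟩
  ext ⟨a, a', b, b', c, c'⟩
  simp only [S2, S1, S0, V, Set.mem_ofPred_eq, Set.mem_singleton_iff, Prod.mk.injEq]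
  omega

lemma S0_card (m : ℕ) : ((S0 (2 * m)).ncard : ℚ) =
    (1) + (19/6)*(m:ℚ)^1 + (43/9)*(m:ℚ)^2 + (9/2)*(m:ℚ)^3 + (47/18)*(m:ℚ)^4 + (5/6)*(m:ℚ)^5 + (1/9)*(m:ℚ)^6 ∧
    ((S0 (2 * m + 1)).ncard : ℚ) =
    (3) + (21/2)*(m:ℚ)^1 + (275/18)*(m:ℚ)^2 + (71/6)*(m:ℚ)^3 + (46/9)*(m:ℚ)^4 + (7/6)*(m:ℚ)^5 + (1/9)*(m:ℚ)^6 := by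
  have step : ∀ k : ℕ, ((S0 (2 * k)).ncard : ℚ) =
    (1) + (19/6)*(k:ℚ)^1 + (43/9)*(k:ℚ)^2 + (9/2)*(k:ℚ)^3 + (47/18)*(k:ℚ)^4 + (5/6)*(k:ℚ)^5 + (1/9)*(k:ℚ)^6 →
    ((S0 (2 * k + 1)).ncard : ℚ) =
    (3) + (21/2)*(k:ℚ)^1 + (275/18)*(k:ℚ)^2 + (71/6)*(k:ℚ)^3 + (46/9)*(k:ℚ)^4 + (7/6)*(k:ℚ)^5 + (1/9)*(k:ℚ)^6 := by
    intro k hk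
    rw [S0_rec]
    push_cast
    rw [hk, (S1_card k).2]
    ring
  induction m with
  | zero =>
    have h0 : ((S0 (2 * 0)).ncard : ℚ) =
    (1) + (19/6)*((0 : ℕ) : ℚ)^1 + (43/9)*((0 : ℕ) : ℚ)^2 + (9/2)*((0 : ℕ) : ℚ)^3 + (47/18)*((0 : ℕ) : ℚ)^4 + (5/6)*((0 : ℕ) : ℚ)^5 + (1/9)*((0 : ℕ) : ℚ)^6 := by
      rw [mul_zero, S0_zero]
      norm_num
    exact ⟨h0, step 0 h0⟩
  | succ m ih =>
    have h1 : ((S0 (2 * (m + 1))).ncard : ℚ) =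
    (1) + (19/6)*((m + 1 : ℕ) : ℚ)^1 + (43/9)*((m + 1 : ℕ) : ℚ)^2 + (9/2)*((m + 1 : ℕ) : ℚ)^3 + (47/18)*((m + 1 : ℕ) : ℚ)^4 + (5/6)*((m + 1 : ℕ) : ℚ)^5 + (1/9)*((m + 1 : ℕ) : ℚ)^6 := by
      have e := (S1_card (m + 1)).1
      rw [show 2 * (m + 1) = 2 * m + 1 + 1 by ring] at e ⊢
      rw [S0_rec]
      push_cast at e ⊢
      rw [ih.2, e]
      ring
    exact ⟨h1, step _ h1⟩

lemma Ssol_S0 (l : ℕ) : (Ssol l).ncard = (S0 l).ncard := by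
  refine nc_bij (fun p : N6 => ((l - (p.1 + p.2.2.1 + p.2.2.2.2.1)) / 2, p.1, p.2.2.1, p.2.2.2.2.1,
    (l - (p.1 + p.2.2.2.1 + p.2.2.2.2.2)) / 2, p.2.2.2.2.2, p.2.2.2.1,
    (l - (p.2.1 + p.2.2.1 + p.2.2.2.2.2)) / 2, p.2.1,
    (l - (p.2.1 + p.2.2.2.1 + p.2.2.2.2.1)) / 2)) ?_ ?_ _ ?_
  · rintro ⟨a, a', b, b', c, c'⟩ ⟨x, x', y, y', z, z'⟩ h
    simp only [Prod.mk.injEq] at h ⊢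
    omega
  · rintro ⟨a11, a12, a13, a14, a22, a23, a24, a33, a34, a44⟩ h
    simp only [Ssol, Set.mem_ofPred_eq] at h
    refine ⟨(a12, a34, a13, a24, a14, a23), ?_⟩
    simp only [Prod.mk.injEq, true_and, and_true]
    omega
  · rintro ⟨a, a', b, b', c, c'⟩
    simp only [Ssol, S0, V, Set.mem_ofPred_eq]
    omega

theorem number_of_solutions_even (ℓ : ℕ) (hℓ : Even ℓ) :
    ((Ssol ℓ).ncard : ℚ) =
      (1/576) * ((ℓ : ℚ) + 2) * ((ℓ : ℚ) + 4) *
        ((ℓ : ℚ) * ((ℓ : ℚ) + 5) * ((ℓ : ℚ) * ((ℓ : ℚ) + 4) + 12) + 72) := by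
  obtain ⟨m, rfl⟩ := hℓ
  rw [← two_mul, Ssol_S0, (S0_card m).1]
  push_cast
  ring
end

section
/- Let ℓ be an odd nonnegative integer. The number of 10-tuples (α11, α12, α13, α14, α22, α23, α24, α33, α34, α44) of nonnegative integers satisfying the system S(ℓ) equals (1/576)·(ℓ+1)·(ℓ+3)·(ℓ·(ℓ+5)·(ℓ·(ℓ+6)+17)+72). -/
set_option linter.unusedSimpArgs false
set_option linter.unnecessarySeqFocus false

theorem cnt_bij {α β : Type*} (X : Set α) (Y : Set β) (f : β → α) (g : α → β)
    (h1 : ∀ y ∈ Y, f y ∈ X ∧ g (f y) = y) (h2 : ∀ x ∈ X, g x ∈ Y ∧ f (g x) = x) :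
    X.ncard = Y.ncard := by
  refine Set.ncard_congr (fun x _ => g x) (fun x hx => (h2 x hx).1) ?_ ?_
  · intro x y hx hy h
    rw [← (h2 x hx).2, ← (h2 y hy).2]
    exact congrArg f h
  · intro y hy
    exact ⟨f y, (h1 y hy).1, (h1 y hy).2⟩

theorem cnt_split {α : Type*} (X : Set α) (hX : X.Finite) (p : α → Prop) :
    X.ncard = {x | x ∈ X ∧ p x}.ncard + {x | x ∈ X ∧ ¬ p x}.ncard := by
  have f1 : {x | x ∈ X ∧ p x}.Finite := hX.subset (fun x h => h.1)
  have f2 : {x | x ∈ X ∧ ¬ p x}.Finite := hX.subset (fun x h => h.1)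
  rw [← Set.ncard_union_eq _ f1 f2]
  · congr 1
    ext x
    simp only [Set.mem_union, Set.mem_ofPred_eq]
    tauto
  · rw [Set.disjoint_left]
    rintro x ⟨_, h⟩ ⟨_, hq⟩
    exact hq h

/-- Pairs with bounded sum. -/
def PP (n : ℕ) : Set (ℕ × ℕ) := {x | x.1 + x.2 ≤ n}
/-- Triples with bounded sum. -/
def STR (j n : ℕ) : Set (ℕ × ℕ × ℕ) := {x | x.1 + x.2.1 + x.2.2 + j ≤ n}
/-- Triples of equal parity with bounded pair sums. -/
def TR (n : ℕ) : Set (ℕ × ℕ × ℕ) :=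
  {x | x.1 % 2 = x.2.1 % 2 ∧ x.1 % 2 = x.2.2 % 2 ∧
    x.1 + x.2.1 ≤ 2 * n ∧ x.1 + x.2.2 ≤ 2 * n ∧ x.2.1 + x.2.2 ≤ 2 * n}

theorem PP_fin (n : ℕ) : (PP n).Finite := by
  refine (Set.finite_Icc (0, 0) (n, n)).subset ?_
  rintro ⟨a, b⟩ h
  simp only [PP, Set.mem_ofPred_eq, Set.mem_Icc, Prod.mk_le_mk, and_true, true_and] at * <;> omega

theorem ST_fin (j n : ℕ) : (STR j n).Finite := by
  refine (Set.finite_Icc (0, 0, 0) (n, n, n)).subset ?_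
  rintro ⟨a, b, c⟩ h
  simp only [STR, Set.mem_ofPred_eq, Set.mem_Icc, Prod.mk_le_mk, and_true, true_and] at * <;> omega

theorem TR_fin (n : ℕ) : (TR n).Finite := by
  refine (Set.finite_Icc (0, 0, 0) (2 * n, 2 * n, 2 * n)).subset ?_
  rintro ⟨a, b, c⟩ h
  simp only [TR, Set.mem_ofPred_eq, Set.mem_Icc, Prod.mk_le_mk, and_true, true_and] at * <;> omega

theorem PP_card (n : ℕ) : ((PP n).ncard : ℚ) = (n + 1) * (n + 2) / 2 := by
  induction n with
  | zero =>
    have : PP 0 = {(0, 0)} := by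
      ext ⟨a, b⟩
      simp only [PP, Set.mem_ofPred_eq, Set.mem_singleton_iff, Prod.mk.injEq]
      omega
    rw [this]
    norm_num
  | succ n ih =>
    rw [cnt_split _ (PP_fin _) (fun x => x.1 = 0)]
    have h1 : {x | x ∈ PP (n + 1) ∧ x.1 = 0}.ncard = (Set.Iic (n + 1)).ncard := by
      refine cnt_bij _ _ (fun y => (0, y)) (fun x => x.2) ?_ ?_
      · intro y h
        simp only [PP, Set.mem_ofPred_eq, Set.mem_Iic, and_true, true_and] at * <;> omega
      · rintro ⟨a, b⟩ h
        simp only [PP, Set.mem_ofPred_eq, Set.mem_Iic, Prod.mk.injEq, and_true, true_and] at * <;> omega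
    have h2 : {x | x ∈ PP (n + 1) ∧ ¬ x.1 = 0}.ncard = (PP n).ncard := by
      refine cnt_bij _ _ (fun y => (y.1 + 1, y.2)) (fun x => (x.1 - 1, x.2)) ?_ ?_ <;>
      · rintro ⟨a, b⟩ h
        simp only [PP, Set.mem_ofPred_eq, Prod.mk.injEq, and_true, true_and] at * <;> omega
    have h3 : (Set.Iic (n + 1)).ncard = n + 2 := by
      rw [← Finset.coe_Iic, Set.ncard_coe_finset, Nat.card_Iic]
    rw [h1, h2, h3]
    push_cast
    rw [ih]
    ring

theorem ST0_card (n : ℕ) : ((STR 0 n).ncard : ℚ) = (n + 1) * (n + 2) * (n + 3) / 6 := by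
  induction n with
  | zero =>
    have : STR 0 0 = {(0, 0, 0)} := by
      ext ⟨a, b, c⟩
      simp only [STR, Set.mem_ofPred_eq, Set.mem_singleton_iff, Prod.mk.injEq]
      omega
    rw [this]
    norm_num
  | succ n ih =>
    rw [cnt_split _ (ST_fin _ _) (fun x => x.1 = 0)]
    have h1 : {x | x ∈ STR 0 (n + 1) ∧ x.1 = 0}.ncard = (PP (n + 1)).ncard := by
      refine cnt_bij _ _ (fun y => (0, y.1, y.2)) (fun x => (x.2.1, x.2.2)) ?_ ?_
      · rintro ⟨a, b⟩ h
        simp only [STR, PP, Set.mem_ofPred_eq, Prod.mk.injEq, and_true, true_and] at * <;> omega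
      · rintro ⟨a, b, c⟩ h
        simp only [STR, PP, Set.mem_ofPred_eq, Prod.mk.injEq, and_true, true_and] at * <;> omega
    have h2 : {x | x ∈ STR 0 (n + 1) ∧ ¬ x.1 = 0}.ncard = (STR 0 n).ncard := by
      refine cnt_bij _ _ (fun y => (y.1 + 1, y.2.1, y.2.2))
        (fun x => (x.1 - 1, x.2.1, x.2.2)) ?_ ?_ <;>
      · rintro ⟨a, b, c⟩ h
        simp only [STR, Set.mem_ofPred_eq, Prod.mk.injEq, and_true, true_and] at * <;> omega
    rw [h1, h2]
    push_cast
    rw [ih, PP_card]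
    push_cast
    ring

theorem ST_shift (j n : ℕ) : STR j (n + j) = STR 0 n := by
  ext ⟨a, b, c⟩
  simp only [STR, Set.mem_ofPred_eq]
  omega

theorem ST_empty (j n : ℕ) (h : n < j) : STR j n = ∅ := by
  ext ⟨a, b, c⟩
  simp only [STR, Set.mem_ofPred_eq, Set.mem_empty_iff_false, iff_false]
  omega

theorem ST1_card (n : ℕ) : ((STR 1 n).ncard : ℚ) = n * (n + 1) * (n + 2) / 6 := by
  rcases n with _ | n
  · rw [ST_empty _ _ (by omega)]
    simp
  · rw [ST_shift, ST0_card]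
    push_cast
    ring

theorem ST2_card (n : ℕ) : ((STR 2 n).ncard : ℚ) = (n - 1) * n * (n + 1) / 6 := by
  rcases n with _ | _ | n
  · rw [ST_empty _ _ (by omega)]
    simp
  · rw [ST_empty _ _ (by omega)]
    simp
  · rw [ST_shift 2 n, ST0_card]
    push_cast
    ring

theorem TR_zero_third (n : ℕ) : {x | x ∈ TR n ∧ x.2.2 = 0}.ncard = (PP n).ncard := by
  refine cnt_bij _ _ (fun y => (2 * y.1, 2 * y.2, 0)) (fun x => (x.1 / 2, x.2.1 / 2)) ?_ ?_
  · rintro ⟨a, b⟩ h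
    simp only [TR, PP, Set.mem_ofPred_eq, Prod.mk.injEq, and_true, true_and] at * <;> omega
  · rintro ⟨a, b, c⟩ h
    simp only [TR, PP, Set.mem_ofPred_eq, Prod.mk.injEq, and_true, true_and] at * <;> omega

theorem TR_card (n : ℕ) :
    ((TR n).ncard : ℚ) = ((n : ℚ) ^ 3 + 3 * (n : ℚ) ^ 2 + 4 * n + 2) / 2 := by
  induction n with
  | zero =>
    have : TR 0 = {(0, 0, 0)} := by
      ext ⟨a, b, c⟩
      simp only [TR, Set.mem_ofPred_eq, Set.mem_singleton_iff, Prod.mk.injEq]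
      omega
    rw [this]
    norm_num
  | succ n ih =>
    have e1 := cnt_split _ (TR_fin (n + 1)) (fun x => x.2.2 = 0)
    have e2 := cnt_split {x | x ∈ TR (n + 1) ∧ ¬ x.2.2 = 0}
      ((TR_fin (n + 1)).subset (fun x h => h.1)) (fun x => x.2.1 = 0)
    have e3 := cnt_split
      {x | x ∈ {x | x ∈ TR (n + 1) ∧ ¬ x.2.2 = 0} ∧ ¬ x.2.1 = 0}
      ((TR_fin (n + 1)).subset (fun x h => h.1.1)) (fun x => x.1 = 0)
    have h1 := TR_zero_third (n + 1)
    have h2 : {x | x ∈ {x | x ∈ TR (n + 1) ∧ ¬ x.2.2 = 0} ∧ x.2.1 = 0}.ncard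
        = (PP n).ncard := by
      refine cnt_bij _ _ (fun y => (2 * y.1, 0, 2 * y.2 + 2))
        (fun x => (x.1 / 2, x.2.2 / 2 - 1)) ?_ ?_
      · rintro ⟨a, b⟩ h
        simp only [TR, PP, Set.mem_ofPred_eq, Prod.mk.injEq, and_true, true_and] at * <;> omega
      · rintro ⟨a, b, c⟩ h
        simp only [TR, PP, Set.mem_ofPred_eq, Prod.mk.injEq, and_true, true_and] at * <;> omega
    have h3 : {x | x ∈ {x | x ∈ {x | x ∈ TR (n + 1) ∧ ¬ x.2.2 = 0} ∧ ¬ x.2.1 = 0}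
        ∧ x.1 = 0}.ncard = {x : ℕ × ℕ | x ∈ PP n ∧ ¬ x.1 = 0}.ncard := by
      refine cnt_bij _ _ (fun y => (0, 2 * y.1, 2 * y.2 + 2))
        (fun x => (x.2.1 / 2, x.2.2 / 2 - 1)) ?_ ?_
      · rintro ⟨a, b⟩ h
        simp only [TR, PP, Set.mem_ofPred_eq, Prod.mk.injEq, and_true, true_and] at * <;> omega
      · rintro ⟨a, b, c⟩ h
        simp only [TR, PP, Set.mem_ofPred_eq, Prod.mk.injEq, and_true, true_and] at * <;> omega
    have h4 : {x | x ∈ {x | x ∈ {x | x ∈ TR (n + 1) ∧ ¬ x.2.2 = 0} ∧ ¬ x.2.1 = 0}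
        ∧ ¬ x.1 = 0}.ncard = (TR n).ncard := by
      refine cnt_bij _ _ (fun y => (y.1 + 1, y.2.1 + 1, y.2.2 + 1))
        (fun x => (x.1 - 1, x.2.1 - 1, x.2.2 - 1)) ?_ ?_ <;>
      · rintro ⟨a, b, c⟩ h
        simp only [TR, Set.mem_ofPred_eq, Prod.mk.injEq, and_true, true_and] at * <;> omega
    have e5 := cnt_split _ (PP_fin n) (fun x => x.1 = 0)
    have h5 : {x | x ∈ PP n ∧ x.1 = 0}.ncard = n + 1 := by
      have : {x | x ∈ PP n ∧ x.1 = 0}.ncard = (Set.Iic n).ncard := by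
        refine cnt_bij _ _ (fun y => (0, y)) (fun x => x.2) ?_ ?_
        · intro y h
          simp only [PP, Set.mem_ofPred_eq, Set.mem_Iic, and_true, true_and] at * <;> omega
        · rintro ⟨a, b⟩ h
          simp only [PP, Set.mem_ofPred_eq, Set.mem_Iic, Prod.mk.injEq, and_true, true_and] at * <;> omega
      rw [this, ← Finset.coe_Iic, Set.ncard_coe_finset, Nat.card_Iic]
    have p0 := PP_card n
    have p1 := PP_card (n + 1)
    have key : (TR (n + 1)).ncard + (n + 1)
        = (PP (n + 1)).ncard + (PP n).ncard + (PP n).ncard + (TR n).ncard := by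
      omega
    have keyq : ((TR (n + 1)).ncard : ℚ) + (n + 1)
        = (PP (n + 1)).ncard + (PP n).ncard + (PP n).ncard + (TR n).ncard := by
      exact_mod_cast key
    rw [p0, p1, ih] at keyq
    push_cast at keyq ⊢
    linear_combination keyq

/-- Same-parity triples with third entry positive. -/
theorem TR1_card (n : ℕ) : (({x | x ∈ TR n ∧ ¬ x.2.2 = 0}.ncard : ℕ) : ℚ)
    = ((n : ℚ) ^ 3 + 2 * (n : ℚ) ^ 2 + n) / 2 := by
  have e : ((TR n).ncard : ℚ) = _ := congrArg Nat.cast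
    (cnt_split _ (TR_fin n) (fun x => x.2.2 = 0))
  rw [TR_zero_third, TR_card] at e
  push_cast at e
  rw [PP_card] at e
  linear_combination -e

/-- Same-parity triples with all entries positive. -/
def TR3 (n : ℕ) : Set (ℕ × ℕ × ℕ) := {x | x ∈ TR n ∧ 0 < x.1 ∧ 0 < x.2.1 ∧ 0 < x.2.2}

theorem TR3_card (n : ℕ) : ((TR3 n).ncard : ℚ) = ((n : ℚ) ^ 3 + n) / 2 := by
  rcases n with _ | n
  · have : TR3 0 = ∅ := by
      ext ⟨a, b, c⟩
      simp only [TR3, TR, Set.mem_ofPred_eq, Set.mem_empty_iff_false, iff_false]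
      omega
    rw [this]
    norm_num
  · have h4 : (TR3 (n + 1)).ncard = (TR n).ncard := by
      refine cnt_bij _ _ (fun y => (y.1 + 1, y.2.1 + 1, y.2.2 + 1))
        (fun x => (x.1 - 1, x.2.1 - 1, x.2.2 - 1)) ?_ ?_ <;>
      · rintro ⟨a, b, c⟩ h
        simp only [TR3, TR, Set.mem_ofPred_eq, Prod.mk.injEq, and_true, true_and] at * <;> omega
    rw [h4, TR_card]
    push_cast
    ring

/-- Six off-diagonal entries, ordered by opposite pairs: 12, 34, 13, 24, 14, 23. -/
abbrev Six := ℕ × ℕ × ℕ × ℕ × ℕ × ℕ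

def SA (m : ℕ) : Set Six :=
  {x | match x with
    | (a, aa, b, bb, c, cc) =>
      (a + b + c ≤ m ∧ (a + b + c) % 2 = m % 2) ∧
      (a + bb + cc ≤ m ∧ (a + bb + cc) % 2 = m % 2) ∧
      (aa + b + cc ≤ m ∧ (aa + b + cc) % 2 = m % 2) ∧
      (aa + bb + c ≤ m ∧ (aa + bb + c) % 2 = m % 2)}
def SB (m : ℕ) : Set Six := {x | x ∈ SA m ∧ ¬ (0 < x.1 ∧ 0 < x.2.1)}
def SC (m : ℕ) : Set Six := {x | x ∈ SB m ∧ ¬ (0 < x.2.2.1 ∧ 0 < x.2.2.2.1)}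
def SD (m : ℕ) : Set Six := {x | x ∈ SC m ∧ ¬ (0 < x.2.2.2.2.1 ∧ 0 < x.2.2.2.2.2)}

theorem SA_fin (m : ℕ) : (SA m).Finite := by
  refine (Set.finite_Icc (0, 0, 0, 0, 0, 0) (m, m, m, m, m, m)).subset ?_
  rintro ⟨a, aa, b, bb, c, cc⟩ h
  simp only [SA, Set.mem_ofPred_eq, Set.mem_Icc, Prod.mk_le_mk, and_true, true_and] at * <;> omega
theorem SB_fin (m : ℕ) : (SB m).Finite := (SA_fin m).subset (fun _ h => h.1)
theorem SC_fin (m : ℕ) : (SC m).Finite := (SB_fin m).subset (fun _ h => h.1)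
theorem SD_fin (m : ℕ) : (SD m).Finite := (SC_fin m).subset (fun _ h => h.1)

theorem Ssol_card (m : ℕ) : (Ssol m).ncard = (SA m).ncard := by
  refine cnt_bij _ _
    (fun y => match y with
      | (a, aa, b, bb, c, cc) => ((m - (a + b + c)) / 2, a, b, c, (m - (a + bb + cc)) / 2, cc, bb,
          (m - (aa + b + cc)) / 2, aa, (m - (aa + bb + c)) / 2))
    (fun x => match x with
      | (_, a12, a13, a14, _, a23, a24, _, a34, _) => (a12, a34, a13, a24, a14, a23)) ?_ ?_
  · rintro ⟨a, aa, b, bb, c, cc⟩ h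
    simp only [SA, Ssol, Set.mem_ofPred_eq, and_true, true_and] at * <;> omega
  · rintro ⟨a11, a12, a13, a14, a22, a23, a24, a33, a34, a44⟩ h
    simp only [SA, Ssol, Set.mem_ofPred_eq, Prod.mk.injEq, and_true, true_and] at * <;> omega

theorem SA_rec (m : ℕ) : (SA (m + 1)).ncard = (SA m).ncard + (SB (m + 1)).ncard := by
  have h : {x | x ∈ SA (m + 1) ∧ (0 < x.1 ∧ 0 < x.2.1)}.ncard = (SA m).ncard := by
    refine cnt_bij _ _ (fun y => (y.1 + 1, y.2.1 + 1, y.2.2.1, y.2.2.2.1, y.2.2.2.2.1, y.2.2.2.2.2))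
      (fun x => (x.1 - 1, x.2.1 - 1, x.2.2.1, x.2.2.2.1, x.2.2.2.2.1, x.2.2.2.2.2)) ?_ ?_ <;>
    · rintro ⟨a, aa, b, bb, c, cc⟩ h
      simp only [SA, Set.mem_ofPred_eq, Prod.mk.injEq, and_true, true_and] at * <;> omega
  rw [← h]
  exact cnt_split _ (SA_fin (m + 1)) _

theorem SA_zero : SA 0 = SB 0 := by
  ext ⟨a, aa, b, bb, c, cc⟩
  simp only [SA, SB, Set.mem_ofPred_eq]
  omega

theorem SB_rec (m : ℕ) : (SB (m + 1)).ncard = (SB m).ncard + (SC (m + 1)).ncard := by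
  have h : {x | x ∈ SB (m + 1) ∧ (0 < x.2.2.1 ∧ 0 < x.2.2.2.1)}.ncard = (SB m).ncard := by
    refine cnt_bij _ _ (fun y => (y.1, y.2.1, y.2.2.1 + 1, y.2.2.2.1 + 1, y.2.2.2.2.1, y.2.2.2.2.2))
      (fun x => (x.1, x.2.1, x.2.2.1 - 1, x.2.2.2.1 - 1, x.2.2.2.2.1, x.2.2.2.2.2)) ?_ ?_ <;>
    · rintro ⟨a, aa, b, bb, c, cc⟩ h
      simp only [SA, SB, Set.mem_ofPred_eq, Prod.mk.injEq, and_true, true_and] at * <;> omega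
  rw [← h]
  exact cnt_split _ (SB_fin (m + 1)) _

theorem SB_zero : SB 0 = SC 0 := by
  ext ⟨a, aa, b, bb, c, cc⟩
  simp only [SA, SB, SC, Set.mem_ofPred_eq]
  omega

theorem SC_rec (m : ℕ) : (SC (m + 1)).ncard = (SC m).ncard + (SD (m + 1)).ncard := by
  have h : {x | x ∈ SC (m + 1) ∧ (0 < x.2.2.2.2.1 ∧ 0 < x.2.2.2.2.2)}.ncard = (SC m).ncard := by
    refine cnt_bij _ _ (fun y => (y.1, y.2.1, y.2.2.1, y.2.2.2.1, y.2.2.2.2.1 + 1, y.2.2.2.2.2 + 1))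
      (fun x => (x.1, x.2.1, x.2.2.1, x.2.2.2.1, x.2.2.2.2.1 - 1, x.2.2.2.2.2 - 1)) ?_ ?_ <;>
    · rintro ⟨a, aa, b, bb, c, cc⟩ h
      simp only [SA, SB, SC, Set.mem_ofPred_eq, Prod.mk.injEq, and_true, true_and] at * <;> omega
  rw [← h]
  exact cnt_split _ (SC_fin (m + 1)) _

theorem SC_zero : SC 0 = SD 0 := by
  ext ⟨a, aa, b, bb, c, cc⟩
  simp only [SA, SB, SC, SD, Set.mem_ofPred_eq]
  omega

/-- The eight octants of SD, by vanishing of the second entry of each opposite pair. -/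
def OC (p q r : Prop) (m : ℕ) : Set Six :=
  {x | ((x ∈ SD m ∧ (x.2.1 = 0 ↔ p)) ∧ (x.2.2.2.1 = 0 ↔ q)) ∧ (x.2.2.2.2.2 = 0 ↔ r)}

theorem SD_octants (m : ℕ) : (SD m).ncard =
    (OC True True True m).ncard + (OC True True False m).ncard +
    (OC True False True m).ncard + (OC True False False m).ncard +
    (OC False True True m).ncard + (OC False True False m).ncard +
    (OC False False True m).ncard + (OC False False False m).ncard := by
  have s1 (X : Set Six) (hX : X.Finite) := cnt_split X hX (fun x => x.2.1 = 0)
  have s2 (X : Set Six) (hX : X.Finite) := cnt_split X hX (fun x => x.2.2.2.1 = 0)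
  have s3 (X : Set Six) (hX : X.Finite) := cnt_split X hX (fun x => x.2.2.2.2.2 = 0)
  have hf := SD_fin m
  rw [s1 _ hf, s2 {x | x ∈ SD m ∧ x.2.1 = 0} (hf.subset (fun _ h => h.1)),
    s2 {x | x ∈ SD m ∧ ¬ x.2.1 = 0} (hf.subset (fun _ h => h.1)),
    s3 {x | x ∈ {x | x ∈ SD m ∧ x.2.1 = 0} ∧ x.2.2.2.1 = 0} (hf.subset (fun _ h => h.1.1)),
    s3 {x | x ∈ {x | x ∈ SD m ∧ x.2.1 = 0} ∧ ¬ x.2.2.2.1 = 0} (hf.subset (fun _ h => h.1.1)),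
    s3 {x | x ∈ {x | x ∈ SD m ∧ ¬ x.2.1 = 0} ∧ x.2.2.2.1 = 0} (hf.subset (fun _ h => h.1.1)),
    s3 {x | x ∈ {x | x ∈ SD m ∧ ¬ x.2.1 = 0} ∧ ¬ x.2.2.2.1 = 0} (hf.subset (fun _ h => h.1.1))]
  simp only [OC, iff_true, iff_false, Set.mem_ofPred_eq]
  omega

theorem OC_TTT_even (n : ℕ) :
    (OC True True True (2 * n)).ncard = (STR 0 n).ncard := by
  refine cnt_bij _ _ (fun y => (2 * y.1, 0, 2 * y.2.1, 0, 2 * y.2.2, 0))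
    (fun x => (x.1 / 2, x.2.2.1 / 2, x.2.2.2.2.1 / 2)) ?_ ?_
  · rintro ⟨a, b, c⟩ h
    simp only [OC, SA, SB, SC, SD, STR, Set.mem_ofPred_eq, Prod.mk.injEq, iff_true, iff_false, and_true, true_and] at * <;> omega
  · rintro ⟨a, aa, b, bb, c, cc⟩ h
    simp only [OC, SA, SB, SC, SD, STR, Set.mem_ofPred_eq, Prod.mk.injEq, iff_true, iff_false, and_true, true_and] at * <;> omega

theorem OC_TTF_even (n : ℕ) :
    (OC True True False (2 * n)).ncard = ({x | x ∈ TR n ∧ ¬ x.2.2 = 0}).ncard := by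
  refine cnt_bij _ _ (fun y => (y.1, 0, y.2.1, 0, 0, y.2.2))
    (fun x => (x.1, x.2.2.1, x.2.2.2.2.2)) ?_ ?_
  · rintro ⟨a, b, c⟩ h
    simp only [OC, SA, SB, SC, SD, TR, Set.mem_ofPred_eq, Prod.mk.injEq, iff_true, iff_false, and_true, true_and] at * <;> omega
  · rintro ⟨a, aa, b, bb, c, cc⟩ h
    simp only [OC, SA, SB, SC, SD, TR, Set.mem_ofPred_eq, Prod.mk.injEq, iff_true, iff_false, and_true, true_and] at * <;> omega

theorem OC_TFT_even (n : ℕ) :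
    (OC True False True (2 * n)).ncard = ({x | x ∈ TR n ∧ ¬ x.2.2 = 0}).ncard := by
  refine cnt_bij _ _ (fun y => (y.1, 0, 0, y.2.2, y.2.1, 0))
    (fun x => (x.1, x.2.2.2.2.1, x.2.2.2.1)) ?_ ?_
  · rintro ⟨a, b, c⟩ h
    simp only [OC, SA, SB, SC, SD, TR, Set.mem_ofPred_eq, Prod.mk.injEq, iff_true, iff_false, and_true, true_and] at * <;> omega
  · rintro ⟨a, aa, b, bb, c, cc⟩ h
    simp only [OC, SA, SB, SC, SD, TR, Set.mem_ofPred_eq, Prod.mk.injEq, iff_true, iff_false, and_true, true_and] at * <;> omega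

theorem OC_TFF_even (n : ℕ) :
    (OC True False False (2 * n)).ncard = (STR 2 n).ncard := by
  refine cnt_bij _ _ (fun y => (2 * y.1, 0, 0, 2 * y.2.1 + 2, 0, 2 * y.2.2 + 2))
    (fun x => (x.1 / 2, x.2.2.2.1 / 2 - 1, x.2.2.2.2.2 / 2 - 1)) ?_ ?_
  · rintro ⟨a, b, c⟩ h
    simp only [OC, SA, SB, SC, SD, STR, Set.mem_ofPred_eq, Prod.mk.injEq, iff_true, iff_false, and_true, true_and] at * <;> omega
  · rintro ⟨a, aa, b, bb, c, cc⟩ h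
    simp only [OC, SA, SB, SC, SD, STR, Set.mem_ofPred_eq, Prod.mk.injEq, iff_true, iff_false, and_true, true_and] at * <;> omega

theorem OC_FTT_even (n : ℕ) :
    (OC False True True (2 * n)).ncard = ({x | x ∈ TR n ∧ ¬ x.2.2 = 0}).ncard := by
  refine cnt_bij _ _ (fun y => (0, y.2.2, y.1, 0, y.2.1, 0))
    (fun x => (x.2.2.1, x.2.2.2.2.1, x.2.1)) ?_ ?_
  · rintro ⟨a, b, c⟩ h
    simp only [OC, SA, SB, SC, SD, TR, Set.mem_ofPred_eq, Prod.mk.injEq, iff_true, iff_false, and_true, true_and] at * <;> omega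
  · rintro ⟨a, aa, b, bb, c, cc⟩ h
    simp only [OC, SA, SB, SC, SD, TR, Set.mem_ofPred_eq, Prod.mk.injEq, iff_true, iff_false, and_true, true_and] at * <;> omega

theorem OC_FTF_even (n : ℕ) :
    (OC False True False (2 * n)).ncard = (STR 2 n).ncard := by
  refine cnt_bij _ _ (fun y => (0, 2 * y.1 + 2, 2 * y.2.1, 0, 0, 2 * y.2.2 + 2))
    (fun x => (x.2.1 / 2 - 1, x.2.2.1 / 2, x.2.2.2.2.2 / 2 - 1)) ?_ ?_
  · rintro ⟨a, b, c⟩ h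
    simp only [OC, SA, SB, SC, SD, STR, Set.mem_ofPred_eq, Prod.mk.injEq, iff_true, iff_false, and_true, true_and] at * <;> omega
  · rintro ⟨a, aa, b, bb, c, cc⟩ h
    simp only [OC, SA, SB, SC, SD, STR, Set.mem_ofPred_eq, Prod.mk.injEq, iff_true, iff_false, and_true, true_and] at * <;> omega

theorem OC_FFT_even (n : ℕ) :
    (OC False False True (2 * n)).ncard = (STR 2 n).ncard := by
  refine cnt_bij _ _ (fun y => (0, 2 * y.1 + 2, 0, 2 * y.2.1 + 2, 2 * y.2.2, 0))
    (fun x => (x.2.1 / 2 - 1, x.2.2.2.1 / 2 - 1, x.2.2.2.2.1 / 2)) ?_ ?_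
  · rintro ⟨a, b, c⟩ h
    simp only [OC, SA, SB, SC, SD, STR, Set.mem_ofPred_eq, Prod.mk.injEq, iff_true, iff_false, and_true, true_and] at * <;> omega
  · rintro ⟨a, aa, b, bb, c, cc⟩ h
    simp only [OC, SA, SB, SC, SD, STR, Set.mem_ofPred_eq, Prod.mk.injEq, iff_true, iff_false, and_true, true_and] at * <;> omega

theorem OC_FFF_even (n : ℕ) :
    (OC False False False (2 * n)).ncard = (TR3 n).ncard := by
  refine cnt_bij _ _ (fun y => (0, y.1, 0, y.2.1, 0, y.2.2))
    (fun x => (x.2.1, x.2.2.2.1, x.2.2.2.2.2)) ?_ ?_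
  · rintro ⟨a, b, c⟩ h
    simp only [OC, SA, SB, SC, SD, TR3, TR, Set.mem_ofPred_eq, Prod.mk.injEq, iff_true, iff_false, and_true, true_and] at * <;> omega
  · rintro ⟨a, aa, b, bb, c, cc⟩ h
    simp only [OC, SA, SB, SC, SD, TR3, TR, Set.mem_ofPred_eq, Prod.mk.injEq, iff_true, iff_false, and_true, true_and] at * <;> omega

theorem OC_TTT_odd (n : ℕ) :
    (OC True True True (2 * n + 1)).ncard = (STR 1 n).ncard := by
  refine cnt_bij _ _ (fun y => (2 * y.1 + 1, 0, 2 * y.2.1 + 1, 0, 2 * y.2.2 + 1, 0))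
    (fun x => (x.1 / 2, x.2.2.1 / 2, x.2.2.2.2.1 / 2)) ?_ ?_
  · rintro ⟨a, b, c⟩ h
    simp only [OC, SA, SB, SC, SD, STR, Set.mem_ofPred_eq, Prod.mk.injEq, iff_true, iff_false, and_true, true_and] at * <;> omega
  · rintro ⟨a, aa, b, bb, c, cc⟩ h
    simp only [OC, SA, SB, SC, SD, STR, Set.mem_ofPred_eq, Prod.mk.injEq, iff_true, iff_false, and_true, true_and] at * <;> omega

theorem OC_TTF_odd (n : ℕ) : (OC True True False (2 * n + 1)).ncard = 0 := by
  have : OC True True False (2 * n + 1) = ∅ := by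
    ext ⟨a, aa, b, bb, c, cc⟩
    simp only [OC, SA, SB, SC, SD, Set.mem_ofPred_eq, iff_true, iff_false, Set.mem_empty_iff_false]
    omega
  rw [this, Set.ncard_empty]

theorem OC_TFT_odd (n : ℕ) : (OC True False True (2 * n + 1)).ncard = 0 := by
  have : OC True False True (2 * n + 1) = ∅ := by
    ext ⟨a, aa, b, bb, c, cc⟩
    simp only [OC, SA, SB, SC, SD, Set.mem_ofPred_eq, iff_true, iff_false, Set.mem_empty_iff_false]
    omega
  rw [this, Set.ncard_empty]

theorem OC_TFF_odd (n : ℕ) :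
    (OC True False False (2 * n + 1)).ncard = (STR 1 n).ncard := by
  refine cnt_bij _ _ (fun y => (2 * y.1 + 1, 0, 0, 2 * y.2.1 + 1, 0, 2 * y.2.2 + 1))
    (fun x => (x.1 / 2, x.2.2.2.1 / 2, x.2.2.2.2.2 / 2)) ?_ ?_
  · rintro ⟨a, b, c⟩ h
    simp only [OC, SA, SB, SC, SD, STR, Set.mem_ofPred_eq, Prod.mk.injEq, iff_true, iff_false, and_true, true_and] at * <;> omega
  · rintro ⟨a, aa, b, bb, c, cc⟩ h
    simp only [OC, SA, SB, SC, SD, STR, Set.mem_ofPred_eq, Prod.mk.injEq, iff_true, iff_false, and_true, true_and] at * <;> omega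

theorem OC_FTT_odd (n : ℕ) : (OC False True True (2 * n + 1)).ncard = 0 := by
  have : OC False True True (2 * n + 1) = ∅ := by
    ext ⟨a, aa, b, bb, c, cc⟩
    simp only [OC, SA, SB, SC, SD, Set.mem_ofPred_eq, iff_true, iff_false, Set.mem_empty_iff_false]
    omega
  rw [this, Set.ncard_empty]

theorem OC_FTF_odd (n : ℕ) :
    (OC False True False (2 * n + 1)).ncard = (STR 1 n).ncard := by
  refine cnt_bij _ _ (fun y => (0, 2 * y.1 + 1, 2 * y.2.1 + 1, 0, 0, 2 * y.2.2 + 1))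
    (fun x => (x.2.1 / 2, x.2.2.1 / 2, x.2.2.2.2.2 / 2)) ?_ ?_
  · rintro ⟨a, b, c⟩ h
    simp only [OC, SA, SB, SC, SD, STR, Set.mem_ofPred_eq, Prod.mk.injEq, iff_true, iff_false, and_true, true_and] at * <;> omega
  · rintro ⟨a, aa, b, bb, c, cc⟩ h
    simp only [OC, SA, SB, SC, SD, STR, Set.mem_ofPred_eq, Prod.mk.injEq, iff_true, iff_false, and_true, true_and] at * <;> omega

theorem OC_FFT_odd (n : ℕ) :
    (OC False False True (2 * n + 1)).ncard = (STR 1 n).ncard := by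
  refine cnt_bij _ _ (fun y => (0, 2 * y.1 + 1, 0, 2 * y.2.1 + 1, 2 * y.2.2 + 1, 0))
    (fun x => (x.2.1 / 2, x.2.2.2.1 / 2, x.2.2.2.2.1 / 2)) ?_ ?_
  · rintro ⟨a, b, c⟩ h
    simp only [OC, SA, SB, SC, SD, STR, Set.mem_ofPred_eq, Prod.mk.injEq, iff_true, iff_false, and_true, true_and] at * <;> omega
  · rintro ⟨a, aa, b, bb, c, cc⟩ h
    simp only [OC, SA, SB, SC, SD, STR, Set.mem_ofPred_eq, Prod.mk.injEq, iff_true, iff_false, and_true, true_and] at * <;> omega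

theorem OC_FFF_odd (n : ℕ) : (OC False False False (2 * n + 1)).ncard = 0 := by
  have : OC False False False (2 * n + 1) = ∅ := by
    ext ⟨a, aa, b, bb, c, cc⟩
    simp only [OC, SA, SB, SC, SD, Set.mem_ofPred_eq, iff_true, iff_false, Set.mem_empty_iff_false]
    omega
  rw [this, Set.ncard_empty]

theorem SD_even (n : ℕ) : ((SD (2 * n)).ncard : ℚ)
    = (8 * (n : ℚ) ^ 3 + 12 * (n : ℚ) ^ 2 + 10 * (n : ℚ) + 3) / 3 := by
  rw [SD_octants, OC_TTT_even, OC_TTF_even, OC_TFT_even, OC_TFF_even, OC_FTT_even, OC_FTF_even, OC_FFT_even, OC_FFF_even]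
  push_cast
  rw [ST0_card, ST2_card, TR1_card, TR3_card]
  ring

theorem SD_odd (n : ℕ) : ((SD (2 * n + 1)).ncard : ℚ)
    = (2 * (n : ℚ) ^ 3 + 6 * (n : ℚ) ^ 2 + 4 * (n : ℚ)) / 3 := by
  rw [SD_octants, OC_TTT_odd, OC_TTF_odd, OC_TFT_odd, OC_TFF_odd, OC_FTT_odd, OC_FTF_odd, OC_FFT_odd, OC_FFF_odd]
  push_cast
  rw [ST1_card]
  ring

theorem SC_even (n : ℕ) : ((SC (2 * n)).ncard : ℚ)
    = (5*(n:ℚ)^4 + 18*(n:ℚ)^3 + 25*(n:ℚ)^2 + 18*(n:ℚ) + 6)/6 := by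
  induction n with
  | zero =>
    have h := SD_even 0
    rw [Nat.mul_zero] at h ⊢
    rw [SC_zero, h]
    norm_num
  | succ n ih =>
    have h1 := SD_odd n
    have h2 := SD_even (n + 1)
    rw [show 2 * (n + 1) = 2 * n + 1 + 1 by ring] at h2 ⊢
    rw [SC_rec, SC_rec]
    push_cast at h2 ⊢
    rw [ih, h1, h2]
    ring

theorem SC_odd (n : ℕ) : ((SC (2 * n + 1)).ncard : ℚ)
    = (5*(n:ℚ)^4 + 22*(n:ℚ)^3 + 37*(n:ℚ)^2 + 26*(n:ℚ) + 6)/6 := by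
  rw [SC_rec]
  push_cast
  rw [SC_even, SD_odd]
  ring

theorem SB_even (n : ℕ) : ((SB (2 * n)).ncard : ℚ)
    = ((n:ℚ)^5 + 5*(n:ℚ)^4 + 11*(n:ℚ)^3 + 13*(n:ℚ)^2 + 9*(n:ℚ) + 3)/3 := by
  induction n with
  | zero =>
    have h := SC_even 0
    rw [Nat.mul_zero] at h ⊢
    rw [SB_zero, h]
    norm_num
  | succ n ih =>
    have h1 := SC_odd n
    have h2 := SC_even (n + 1)
    rw [show 2 * (n + 1) = 2 * n + 1 + 1 by ring] at h2 ⊢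
    rw [SB_rec, SB_rec]
    push_cast at h2 ⊢
    rw [ih, h1, h2]
    ring

theorem SB_odd (n : ℕ) : ((SB (2 * n + 1)).ncard : ℚ)
    = (2*(n:ℚ)^5 + 15*(n:ℚ)^4 + 44*(n:ℚ)^3 + 63*(n:ℚ)^2 + 44*(n:ℚ) + 12)/6 := by
  rw [SB_rec]
  push_cast
  rw [SB_even, SC_odd]
  ring

theorem SA_even (n : ℕ) : ((SA (2 * n)).ncard : ℚ)
    = (2*(n:ℚ)^6 + 15*(n:ℚ)^5 + 47*(n:ℚ)^4 + 81*(n:ℚ)^3 + 86*(n:ℚ)^2 + 57*(n:ℚ) + 18)/18 := by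
  induction n with
  | zero =>
    have h := SB_even 0
    rw [Nat.mul_zero] at h ⊢
    rw [SA_zero, h]
    norm_num
  | succ n ih =>
    have h1 := SB_odd n
    have h2 := SB_even (n + 1)
    rw [show 2 * (n + 1) = 2 * n + 1 + 1 by ring] at h2 ⊢
    rw [SA_rec, SA_rec]
    push_cast at h2 ⊢
    rw [ih, h1, h2]
    ring

theorem SA_odd (n : ℕ) : ((SA (2 * n + 1)).ncard : ℚ)
    = (2*(n:ℚ)^6 + 21*(n:ℚ)^5 + 92*(n:ℚ)^4 + 213*(n:ℚ)^3 + 275*(n:ℚ)^2 + 189*(n:ℚ) + 54)/18 := by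
  rw [SA_rec]
  push_cast
  rw [SA_even, SB_odd]
  ring

theorem number_of_solutions_odd (ℓ : ℕ) (hℓ : Odd ℓ) :
    ((Ssol ℓ).ncard : ℚ) =
      (1/576) * ((ℓ : ℚ) + 1) * ((ℓ : ℚ) + 3) *
        ((ℓ : ℚ) * ((ℓ : ℚ) + 5) * ((ℓ : ℚ) * ((ℓ : ℚ) + 6) + 17) + 72) := by
  obtain ⟨n, rfl⟩ := hℓ
  rw [Ssol_card, SA_odd]
  push_cast
  ring
end

section
/- Let ℓ be an even nonnegative integer. The number of 6-tuples (α11, α12, α13, α22, α23, α33) of nonnegative integers satisfying the system T(ℓ) equals (1/16)·(ℓ+2)·(ℓ²+4ℓ+8). -/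
/-- The Diophantine system T(ℓ): three equations in six nonnegative integer unknowns. -/
def Tsol (ℓ : ℕ) : Set (ℕ × ℕ × ℕ × ℕ × ℕ × ℕ) :=
  {p | match p with
       | (a11, a12, a13, a22, a23, a33) =>
         2*a11 + a12 + a13 = ℓ ∧
         a12 + 2*a22 + a23 = ℓ ∧
         a13 + a23 + 2*a33 = ℓ}


/-- Pairs of naturals with sum less than `k`. -/
def triPairs (k : ℕ) : Finset (ℕ × ℕ) :=
  (Finset.range k).biUnion (fun i => Finset.HasAntidiagonal.antidiagonal i)

theorem mem_triPairs (k a b : ℕ) : (a, b) ∈ triPairs k ↔ a + b < k := by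
  simp [triPairs]

theorem card_triPairs (k : ℕ) : 2 * (triPairs k).card = k * (k + 1) := by
  have h : (triPairs k).card = ∑ i ∈ Finset.range k, (i + 1) := by
    unfold triPairs
    rw [Finset.card_biUnion]
    · simp
    · intro i _ j _ hij
      rw [Function.onFun, Finset.disjoint_left]
      rintro ⟨a, b⟩ h1 h2
      simp at h1 h2
      omega
  rw [h]
  clear h
  induction k with
  | zero => simp
  | succ k ih => rw [Finset.sum_range_succ, mul_add, ih]; ring

/-- Shift all off-diagonal unknowns by one. -/
def shiftSol : ℕ × ℕ × ℕ × ℕ × ℕ × ℕ → ℕ × ℕ × ℕ × ℕ × ℕ × ℕ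
  | (a, b, c, d, e, f) => (a, b + 1, c + 1, d, e + 1, f)

/-- Solutions with `a23 = 0`. -/
def solA (M : ℕ) (p : ℕ × ℕ) : ℕ × ℕ × ℕ × ℕ × ℕ × ℕ :=
  (M - p.1 - p.2, 2 * p.1, 2 * p.2, M - p.1, 0, M - p.2)

/-- Solutions with `a13 = 0` and `a23 > 0`. -/
def solB (M : ℕ) (p : ℕ × ℕ) : ℕ × ℕ × ℕ × ℕ × ℕ × ℕ :=
  (M - p.1, 2 * p.1, 0, M - p.1 - p.2 - 1, 2 * p.2 + 2, M - p.2 - 1)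

/-- Solutions with `a12 = 0` and `a13, a23 > 0`. -/
def solC (M : ℕ) (p : ℕ × ℕ) : ℕ × ℕ × ℕ × ℕ × ℕ × ℕ :=
  (M - p.1 - 1, 0, 2 * p.1 + 2, M - p.2 - 1, 2 * p.2 + 2, M - p.1 - p.2 - 2)

theorem exists_finset_Tsol (m : ℕ) : ∃ S : Finset (ℕ × ℕ × ℕ × ℕ × ℕ × ℕ),
    (S : Set _) = Tsol (2 * m) ∧ 2 * S.card = (m + 1) * (m ^ 2 + 2 * m + 2) := by
  induction m with
  | zero =>
    refine ⟨{(0, 0, 0, 0, 0, 0)}, ?_, by simp⟩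
    ext ⟨a, b, c, d, e, f⟩
    simp only [Tsol, Finset.coe_singleton, Set.mem_singleton_iff, Set.mem_ofPred_eq, Prod.mk.injEq]
    omega
  | succ m ih =>
    obtain ⟨S, hS, hc⟩ := ih
    have hmem : ∀ a b c d e f, (a, b, c, d, e, f) ∈ S ↔
        2 * a + b + c = 2 * m ∧ b + 2 * d + e = 2 * m ∧ c + e + 2 * f = 2 * m := by
      intro a b c d e f
      rw [← Finset.mem_coe, hS]
      rfl
    have c0 : (S.image shiftSol).card = S.card := by
      apply Finset.card_image_of_injective
      rintro ⟨a, b, c, d, e, f⟩ ⟨a', b', c', d', e', f'⟩ h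
      simp only [shiftSol, Prod.mk.injEq] at h ⊢
      omega
    have cA : ((triPairs (m + 2)).image (solA (m + 1))).card = (triPairs (m + 2)).card := by
      apply Finset.card_image_of_injective
      rintro ⟨a, b⟩ ⟨a', b'⟩ h
      simp only [solA, Prod.mk.injEq] at h ⊢
      omega
    have cB : ((triPairs (m + 1)).image (solB (m + 1))).card = (triPairs (m + 1)).card := by
      apply Finset.card_image_of_injective
      rintro ⟨a, b⟩ ⟨a', b'⟩ h
      simp only [solB, Prod.mk.injEq] at h ⊢
      omega
    have cC : ((triPairs m).image (solC (m + 1))).card = (triPairs m).card := by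
      apply Finset.card_image_of_injective
      rintro ⟨a, b⟩ ⟨a', b'⟩ h
      simp only [solC, Prod.mk.injEq] at h ⊢
      omega
    refine ⟨((S.image shiftSol ∪ (triPairs (m + 2)).image (solA (m + 1))) ∪
      (triPairs (m + 1)).image (solB (m + 1))) ∪ (triPairs m).image (solC (m + 1)), ?_, ?_⟩
    · ext ⟨a, b, c, d, e, f⟩
      simp only [Finset.coe_union, Finset.coe_image, Set.mem_union, Set.mem_image,
        Finset.mem_coe, Prod.exists, mem_triPairs, hmem, shiftSol, solA, solB, solC,
        Prod.mk.injEq, Tsol, Set.mem_ofPred_eq]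
      constructor
      · rintro (((⟨a', b', c', d', e', f', h⟩ | ⟨x, y, h⟩) | ⟨x, y, h⟩) | ⟨x, y, h⟩) <;> omega
      · intro h
        by_cases he : e = 0
        · exact Or.inl (Or.inl (Or.inr ⟨b / 2, c / 2, by omega⟩))
        by_cases hcc : c = 0
        · exact Or.inl (Or.inr ⟨b / 2, e / 2 - 1, by omega⟩)
        by_cases hb : b = 0
        · exact Or.inr ⟨c / 2 - 1, e / 2 - 1, by omega⟩
        · exact Or.inl (Or.inl (Or.inl ⟨a, b - 1, c - 1, d, e - 1, f, by omega⟩))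
    · rw [Finset.card_union_of_disjoint, Finset.card_union_of_disjoint,
        Finset.card_union_of_disjoint, c0, cA, cB, cC]
      · have h1 := card_triPairs (m + 2)
        have h2 := card_triPairs (m + 1)
        have h3 := card_triPairs m
        nlinarith
      all_goals
        rw [Finset.disjoint_left]
        rintro ⟨a, b, c, d, e, f⟩ h1 h2
        simp only [Finset.mem_union, Finset.mem_image, Prod.exists, mem_triPairs, hmem, shiftSol,
          solA, solB, solC, Prod.mk.injEq] at h1 h2
        obtain ⟨x, y, h2⟩ := h2
      · obtain ⟨a', b', c', d', e', f', h⟩ := h1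
        omega
      · rcases h1 with ⟨a', b', c', d', e', f', h⟩ | ⟨x', y', h⟩ <;> omega
      · rcases h1 with (⟨a', b', c', d', e', f', h⟩ | ⟨x', y', h⟩) | ⟨x', y', h⟩ <;> omega

theorem number_of_solutions_T_even (ℓ : ℕ) (hℓ : Even ℓ) :
    ((Tsol ℓ).ncard : ℚ) =
      (1/16) * ((ℓ : ℚ) + 2) * ((ℓ : ℚ)^2 + 4*(ℓ : ℚ) + 8) := by
  obtain ⟨m, rfl⟩ := hℓ
  obtain ⟨S, hS, hc⟩ := exists_finset_Tsol m
  rw [← two_mul, ← hS, Set.ncard_coe_finset]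
  have h : (2 : ℚ) * S.card = (m + 1) * (m ^ 2 + 2 * m + 2) := by exact_mod_cast hc
  push_cast
  linarith
end

section
/- Let ℓ be an even nonnegative integer and let α11, α22, α33 be nonnegative integers with 2α11 ≤ ℓ, 2α22 ≤ ℓ, 2α33 ≤ ℓ. Set ℓ11 = ℓ − 2α11, ℓ22 = ℓ − 2α22, ℓ33 = ℓ − 2α33. Then there exist nonnegative integers α12, α13, α23 such that (α11, α12, α13, α22, α23, α33) solves T(ℓ) if and only if |ℓ22 − ℓ11| ≤ ℓ33 ≤ ℓ11 + ℓ22. -/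
theorem solution_exists_iff_triangle (ℓ a11 a22 a33 : ℕ) (hℓ : Even ℓ)
    (h1 : 2*a11 ≤ ℓ) (h2 : 2*a22 ≤ ℓ) (h3 : 2*a33 ≤ ℓ) :
    (∃ a12 a13 a23 : ℕ,
        2*a11 + a12 + a13 = ℓ ∧
        a12 + 2*a22 + a23 = ℓ ∧
        a13 + a23 + 2*a33 = ℓ) ↔
    (|((ℓ : ℤ) - 2*(a22 : ℤ)) - ((ℓ : ℤ) - 2*(a11 : ℤ))| ≤ (ℓ : ℤ) - 2*(a33 : ℤ) ∧
     (ℓ : ℤ) - 2*(a33 : ℤ) ≤ ((ℓ : ℤ) - 2*(a11 : ℤ)) + ((ℓ : ℤ) - 2*(a22 : ℤ))) := by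
  obtain ⟨m, rfl⟩ := hℓ
  rw [abs_le]
  constructor
  · rintro ⟨a12, a13, a23, e1, e2, e3⟩
    omega
  · rintro ⟨⟨h4, h5⟩, h6⟩
    exact ⟨m + a33 - a11 - a22, m + a22 - a11 - a33, m + a11 - a22 - a33,
      by omega, by omega, by omega⟩
end

section
/- Let ℓ be a nonnegative integer and let α11, α22, α33, α44 be nonnegative integers with 2αii ≤ ℓ for each i. Set ℓii = ℓ − 2αii for i = 1, 2, 3, 4. If ℓ11 ≤ ℓ22 and ℓ22 − ℓ11 ≤ ℓ33 + ℓ44 ≤ ℓ11 + ℓ22, then the reduced system R(ℓ11, ℓ22, ℓ33, ℓ44) has a solution in nonnegative integers (α12, α13, α14, α23, α24, α34). -/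
theorem reduced_system_solvable (ℓ a11 a22 a33 a44 : ℕ)
    (h1 : 2*a11 ≤ ℓ) (h2 : 2*a22 ≤ ℓ) (h3 : 2*a33 ≤ ℓ) (h4 : 2*a44 ≤ ℓ)
    (h5 : ℓ - 2*a11 ≤ ℓ - 2*a22)
    (h6 : (ℓ - 2*a22) - (ℓ - 2*a11) ≤ (ℓ - 2*a33) + (ℓ - 2*a44))
    (h7 : (ℓ - 2*a33) + (ℓ - 2*a44) ≤ (ℓ - 2*a11) + (ℓ - 2*a22)) :
    ∃ a12 a13 a14 a23 a24 a34 : ℕ,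
      a12 + a13 + a14 = ℓ - 2*a11 ∧
      a12 + a23 + a24 = ℓ - 2*a22 ∧
      a13 + a23 + a34 = ℓ - 2*a33 ∧
      a14 + a24 + a34 = ℓ - 2*a44 := by
  obtain ⟨x, hx⟩ : ∃ x, x + a11 + a22 = a33 + a44 := ⟨a33 + a44 - a11 - a22, by omega⟩
  rcases le_total (ℓ - 2*a11 - x) (ℓ - 2*a33) with h | h
  · exact ⟨x, ℓ - 2*a11 - x, 0, ℓ - 2*a33 - (ℓ - 2*a11 - x), ℓ - 2*a44, 0,
      by omega, by omega, by omega, by omega⟩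
  · exact ⟨x, ℓ - 2*a33, ℓ - 2*a11 - x - (ℓ - 2*a33), 0,
      ℓ - 2*a44 - (ℓ - 2*a11 - x - (ℓ - 2*a33)), 0,
      by omega, by omega, by omega, by omega⟩
end

section
/- Let ℓ be an even nonnegative integer and let a, b be even integers with 0 ≤ a < b ≤ ℓ and ℓ ≥ a + b − 2. Then N−(ℓ,a,b) = Σ_{t=1}^{a/2} t(2t−1)·((b−a)/2 − 1) + Σ_{t=1}^{a/2} t(2t+1)·(b−a)/2 + 2·Σ_{t=1}^{a/2} t(2t−1)·(a − 2t + 2). -/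
open Finset

/-- N−(ℓ,a,b): the number of 8-tuples (α12, α13, α14, α23, α24, α34, c, d) where c, d
are even with 0 ≤ c, d ≤ ℓ, c + d < a + b, and the α's solve the reduced system
R(a,b,c,d). -/
noncomputable def Nminus (ℓ a b : ℕ) : ℕ :=
  Set.ncard {p : ℕ × ℕ × ℕ × ℕ × ℕ × ℕ × ℕ × ℕ |
    match p with
    | (a12, a13, a14, a23, a24, a34, c, d) =>
      Even c ∧ Even d ∧ c ≤ ℓ ∧ d ≤ ℓ ∧ c + d < a + b ∧
      a12 + a13 + a14 = a ∧
      a12 + a23 + a24 = b ∧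
      a13 + a23 + a34 = c ∧
      a14 + a24 + a34 = d}


lemma parity_count (m n k : ℕ) (h : Even m ∨ Even n) :
    (2 : ℚ) * (((range m ×ˢ range n ×ˢ range k).filter
      (fun p => Even (p.1 + p.2.1 + p.2.2))).card : ℚ) = m * n * k := by
  have h1 : ∀ p : ℕ, (2 : ℚ) * (if Even p then 1 else 0) = 1 + (-1) ^ p := by
    intro p
    split_ifs with hp
    · rw [hp.neg_one_pow]; norm_num
    · rw [(Nat.not_even_iff_odd.mp hp).neg_one_pow]; norm_num
  rw [card_filter]
  push_cast
  rw [mul_sum]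
  simp_rw [h1]
  rw [sum_add_distrib]
  have h2 : ∑ p ∈ range m ×ˢ range n ×ˢ range k, (-1 : ℚ) ^ (p.1 + p.2.1 + p.2.2) =
      (∑ i ∈ range m, (-1 : ℚ) ^ i) * ((∑ i ∈ range n, (-1 : ℚ) ^ i) *
        (∑ i ∈ range k, (-1 : ℚ) ^ i)) := by
    rw [sum_mul_sum, ← sum_product', sum_mul_sum, ← sum_product']
    refine sum_congr rfl fun p _ => ?_
    rw [pow_add, pow_add, mul_assoc]
  rw [h2, neg_one_geom_sum, neg_one_geom_sum]
  rcases h with h | h <;> simp [h, mul_assoc]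

lemma Nminus_sum (ℓ a b : ℕ) (ha : Even a) (hb : Even b)
    (hab : a < b) (hcase : a + b ≤ ℓ + 2) :
    (Nminus ℓ a b : ℚ) =
      ∑ x ∈ range (a + 1), (x : ℚ) * ((a : ℚ) - x + 1) * ((b : ℚ) - x + 1) / 2 := by
  let T : Finset (Σ _ : ℕ, ℕ × ℕ × ℕ) := (range (a + 1)).sigma (fun x =>
    (range x ×ˢ range (a - x + 1) ×ˢ range (b - x + 1)).filter
      (fun p => Even (p.1 + p.2.1 + p.2.2)))
  let f : (Σ _ : ℕ, ℕ × ℕ × ℕ) → ℕ × ℕ × ℕ × ℕ × ℕ × ℕ × ℕ × ℕ := fun p =>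
    (p.1, p.2.2.1, a - p.1 - p.2.2.1, p.2.2.2, b - p.1 - p.2.2.2, p.2.1,
      p.2.2.1 + p.2.2.2 + p.2.1,
      (a - p.1 - p.2.2.1) + (b - p.1 - p.2.2.2) + p.2.1)
  classical
  have hf : Function.Injective f := by
    rintro ⟨x, y, i, j⟩ ⟨x', y', i', j'⟩ h
    simp only [f, Prod.mk.injEq] at h
    obtain ⟨rfl, rfl, -, rfl, -, rfl, -⟩ := h
    rfl
  have hN : Nminus ℓ a b = T.card := by
    rw [← card_image_of_injective T hf, ← Set.ncard_coe_finset, Nminus]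
    congr 1
    ext ⟨a12, a13, a14, a23, a24, a34, c, d⟩
    simp only [Set.mem_setOf_eq, coe_image, Set.mem_image, mem_coe, T, f, mem_sigma, mem_filter,
      mem_product, mem_range, Prod.mk.injEq, Nat.even_iff] at ha hb ⊢
    constructor
    · rintro ⟨h1, h2, h3, h4, h5, h6, h7, h8, h9⟩
      refine ⟨⟨a12, a34, a13, a23⟩, ?_⟩
      dsimp only
      refine ⟨⟨?_, ⟨?_, ?_, ?_⟩, ?_⟩, ?_, ?_, ?_, ?_, ?_, ?_, ?_, ?_⟩ <;> omega
    · rintro ⟨⟨x, y, i, j⟩, ⟨h1, ⟨h2, h3, h4⟩, h5⟩, g1, g2, g3, g4, g5, g6, g7, g8⟩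
      dsimp only at *
      refine ⟨?_, ?_, ?_, ?_, ?_, ?_, ?_, ?_, ?_⟩ <;> omega
  rw [hN, card_sigma]
  push_cast
  refine sum_congr rfl fun x hx => ?_
  have hx' : x ≤ a := by simpa [Nat.lt_succ_iff] using hx
  have hp := parity_count x (a - x + 1) (b - x + 1) (by
    simp only [Nat.even_iff] at *; omega)
  rw [eq_div_iff (by norm_num), mul_comm, hp]
  push_cast [Nat.cast_sub hx', Nat.cast_sub (hx'.trans hab.le)]
  ring

lemma sum_lhs (A B : ℚ) (n : ℕ) :
    ∑ x ∈ range (n + 1), (x : ℚ) * (A - x + 1) * (B - x + 1) / 2 =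
      ((A + 1) * (B + 1) * (n * (n + 1) / 2) - (A + B + 2) * (n * (n + 1) * (2 * n + 1) / 6)
        + (n * (n + 1) / 2) ^ 2) / 2 := by
  induction n with
  | zero => simp
  | succ k ih => rw [sum_range_succ, ih]; push_cast; ring

lemma sum_rhs (A B : ℚ) (n : ℕ) :
    (∑ t ∈ Icc 1 n, (t : ℚ) * (2*(t : ℚ) - 1) * ((B - A)/2 - 1)) +
      (∑ t ∈ Icc 1 n, (t : ℚ) * (2*(t : ℚ) + 1) * ((B - A)/2)) +
      2 * ∑ t ∈ Icc 1 n, (t : ℚ) * (2*(t : ℚ) - 1) * (A - 2*(t : ℚ) + 2) =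
    (2 * (n * (n + 1) * (2 * n + 1) / 6) - n * (n + 1) / 2) * ((B - A)/2 - 1)
    + (2 * (n * (n + 1) * (2 * n + 1) / 6) + n * (n + 1) / 2) * ((B - A)/2)
    + 2 * ((A + 2) * (2 * (n * (n + 1) * (2 * n + 1) / 6) - n * (n + 1) / 2)
      - 4 * (n * (n + 1) / 2) ^ 2 + 2 * (n * (n + 1) * (2 * n + 1) / 6)) := by
  induction n with
  | zero => simp
  | succ k ih =>
    simp only [sum_Icc_succ_top (Nat.le_add_left 1 k)]
    rw [mul_add]
    push_cast
    linear_combination ih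

theorem Nminus_lt_large_ell (ℓ a b : ℕ) (hℓ : Even ℓ) (ha : Even a) (hb : Even b)
    (hab : a < b) (hbl : b ≤ ℓ) (hcase : a + b ≤ ℓ + 2) :
    (Nminus ℓ a b : ℚ) =
      (∑ t ∈ Icc 1 (a/2), (t : ℚ) * (2*(t : ℚ) - 1) * (((b : ℚ) - a)/2 - 1)) +
      (∑ t ∈ Icc 1 (a/2), (t : ℚ) * (2*(t : ℚ) + 1) * (((b : ℚ) - a)/2)) +
      2 * ∑ t ∈ Icc 1 (a/2), (t : ℚ) * (2*(t : ℚ) - 1) * ((a : ℚ) - 2*(t : ℚ) + 2) := by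
  rw [Nminus_sum ℓ a b ha hb hab hcase, sum_lhs, sum_rhs]
  obtain ⟨m, rfl⟩ := ha
  have : (m + m) / 2 = m := by omega
  rw [this]
  push_cast
  ring
end

section
/- Let ℓ be an even nonnegative integer and let a be an even integer with 0 ≤ a ≤ ℓ and ℓ ≥ 2a − 2. Then N−(ℓ,a,a) = −Σ_{t=1}^{a/2} t(2t−1) + 2·Σ_{t=1}^{a/2} t(2t−1)·(a − 2t + 2). -/
open Finset

/-- Parameters `(x, (y, i, j))` stand for `a12 = x`, `a34 = y`, `a13 = i`, `a23 = j`. -/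
def paramBox (x s : ℕ) : Finset (ℕ × ℕ × ℕ) :=
  (range x ×ˢ range (s+1) ×ˢ range (s+1)).filter (fun p => Even (p.1 + p.2.1 + p.2.2))

lemma two_ite_even (n : ℕ) : (2:ℤ) * (if Even n then 1 else 0) = 1 + (-1)^n := by
  split_ifs with h
  · rw [h.neg_one_pow]; norm_num
  · rw [(Nat.not_even_iff_odd.mp h).neg_one_pow]; norm_num

lemma paramBox_card (x s : ℕ) (h : Even (x + s)) :
    (2:ℤ) * ((paramBox x s).card : ℤ) = x * (s+1)^2 := by
  have h1 : (2:ℤ) * ((paramBox x s).card : ℤ) =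
      ∑ y ∈ range x, ∑ i ∈ range (s+1), ∑ j ∈ range (s+1),
        (1 + (-1:ℤ)^y * ((-1)^i * (-1)^j)) := by
    rw [paramBox, card_filter, sum_product, Nat.cast_sum, mul_sum]
    refine sum_congr rfl fun y _ => ?_
    rw [sum_product, Nat.cast_sum, mul_sum]
    refine sum_congr rfl fun i _ => ?_
    rw [Nat.cast_sum, mul_sum]
    refine sum_congr rfl fun j _ => ?_
    have := two_ite_even (y + i + j)
    push_cast
    rw [this]; ring
  rw [h1]
  simp only [sum_add_distrib, ← mul_sum, ← sum_mul, neg_one_geom_sum]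
  have h2 : Even x ∨ Even (s+1) := by
    rcases Nat.even_or_odd x with hx | hx
    · exact Or.inl hx
    · right
      rw [Nat.even_add] at h
      have : ¬ Even s := fun hs => (Nat.not_even_iff_odd.mpr hx) (h.mpr hs)
      exact Nat.even_add_one.mpr this
  rcases h2 with h2 | h2 <;> simp [h2] <;> ring_nf <;> simp

/-- The full parameter set. -/
def params (a : ℕ) : Finset ((_ : ℕ) × (ℕ × ℕ × ℕ)) :=
  (range (a+1)).sigma fun x => paramBox x (a - x)

/-- The 8-tuple attached to a parameter. -/
def toTuple (a : ℕ) (p : (_ : ℕ) × (ℕ × ℕ × ℕ)) : ℕ × ℕ × ℕ × ℕ × ℕ × ℕ × ℕ × ℕ :=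
  (p.1, p.2.2.1, a - p.1 - p.2.2.1, p.2.2.2, a - p.1 - p.2.2.2, p.2.1,
    p.2.2.1 + p.2.2.2 + p.2.1, (a - p.1 - p.2.2.1) + (a - p.1 - p.2.2.2) + p.2.1)

lemma Nminus_eq_card (ℓ a : ℕ) (hcase : 2*a ≤ ℓ + 2) :
    Nminus ℓ a a = (params a).card := by
  have hinj : Function.Injective (toTuple a) := by
    rintro ⟨x, y, i, j⟩ ⟨x', y', i', j'⟩ h
    simp only [toTuple, Prod.mk.injEq] at h
    obtain ⟨rfl, rfl, -, rfl, -, rfl, -⟩ := h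
    rfl
  rw [← Set.ncard_coe_finset, ← Set.ncard_image_of_injective _ hinj, Nminus]
  congr 1
  ext ⟨a12, a13, a14, a23, a24, a34, c, d⟩
  simp only [Set.mem_setOf_eq, Set.mem_image, Finset.mem_coe, params, paramBox, mem_sigma,
    mem_filter, mem_product, mem_range, toTuple, Prod.mk.injEq, Nat.even_iff]
  constructor
  · rintro ⟨h1, h2, h3, h4, h5, h6, h7, h8, h9⟩
    refine ⟨⟨a12, a34, a13, a23⟩, ?_⟩
    dsimp only
    refine ⟨⟨?_, ⟨?_, ?_, ?_⟩, ?_⟩, ?_, ?_, ?_, ?_, ?_, ?_, ?_, ?_⟩ <;> omega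
  · rintro ⟨⟨x, y, i, j⟩, h⟩
    dsimp only at h
    obtain ⟨⟨h1, ⟨h2, h3, h4⟩, h5⟩, rfl, rfl, h6, rfl, h7, rfl, h8, h9⟩ := h
    refine ⟨?_, ?_, ?_, ?_, ?_, ?_, ?_, ?_, ?_⟩ <;> omega

lemma sum_cube_aux (n : ℕ) (b : ℚ) :
    ∑ x ∈ range (n+1), (x:ℚ) * (b - x)^2 =
      b^2 * (n*(n+1)/2) - 2*b*(n*(n+1)*(2*n+1)/6) + (n*(n+1)/2)^2 := by
  induction n with
  | zero => simp
  | succ k ih => rw [sum_range_succ, ih]; push_cast; ring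

lemma rhs_aux1 (m : ℕ) :
    ∑ t ∈ Icc 1 m, (t : ℚ) * (2*(t : ℚ) - 1) = m*(m+1)*(2*m+1)/3 - m*(m+1)/2 := by
  induction m with
  | zero => simp
  | succ k ih => rw [sum_Icc_succ_top (by omega), ih]; push_cast; ring

lemma rhs_aux2 (m : ℕ) (b : ℚ) :
    ∑ t ∈ Icc 1 m, (t : ℚ) * (2*(t : ℚ) - 1) * (b - 2*(t : ℚ) + 2) =
      (b+2) * (m*(m+1)*(2*m+1)/3 - m*(m+1)/2)
        - 4 * (m*(m+1)/2)^2 + 2 * (m*(m+1)*(2*m+1)/6) := by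
  induction m with
  | zero => simp
  | succ k ih => rw [sum_Icc_succ_top (by omega), ih]; push_cast; ring

theorem Nminus_eq_large_ell (ℓ a : ℕ) (hℓ : Even ℓ) (ha : Even a)
    (hal : a ≤ ℓ) (hcase : 2*a ≤ ℓ + 2) :
    (Nminus ℓ a a : ℚ) =
      -(∑ t ∈ Icc 1 (a/2), (t : ℚ) * (2*(t : ℚ) - 1)) +
      2 * ∑ t ∈ Icc 1 (a/2), (t : ℚ) * (2*(t : ℚ) - 1) * ((a : ℚ) - 2*(t : ℚ) + 2) := by
  have key : (2:ℚ) * (Nminus ℓ a a : ℚ) = ∑ x ∈ range (a+1), (x:ℚ) * (((a:ℚ)+1) - x)^2 := by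
    rw [Nminus_eq_card ℓ a hcase, params, card_sigma, Nat.cast_sum, mul_sum]
    refine sum_congr rfl fun x hx => ?_
    have hx' : x ≤ a := by simpa [Nat.lt_succ_iff] using hx
    have h := paramBox_card x (a - x) (by rwa [Nat.add_sub_cancel' hx'])
    have h' : (2:ℚ) * ((paramBox x (a-x)).card : ℚ) = x * (((a - x : ℕ):ℚ)+1)^2 := by
      exact_mod_cast h
    rw [h', Nat.cast_sub hx']; ring
  rw [sum_cube_aux] at key
  rw [rhs_aux1, rhs_aux2]
  obtain ⟨m, rfl⟩ := ha
  have hm : (m + m) / 2 = m := by omega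
  rw [hm]
  push_cast at key ⊢
  linarith
end

section
/- Let ℓ be an even nonnegative integer and let a, b be even integers with 0 ≤ a < b ≤ ℓ and ℓ < a + b − 2. Then N−(ℓ,a,b) = Σ_{t=1}^{a/2} t(2t−1)·((b−a)/2 − 1) + Σ_{t=1}^{a/2} t(2t+1)·(b−a)/2 + 2·Σ_{t=1}^{a/2} t(2t−1)·(a − 2t + 2) − 2·Σ_{t=1}^{(a+b−ℓ)/2 − 1} t(2t−1)·((a+b−ℓ)/2 − t). -/
open Finset

/-- All solutions with `a34 < a12`, parametrised by (a12, a34, a13, a23). -/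
def Pfin (a b : ℕ) : Finset ((_ : ℕ) × (_ : ℕ) × (_ : ℕ) × ℕ) :=
  (range (a+1)).sigma fun x => (range x).sigma fun w => (range (a-x+1)).sigma fun y =>
    (range (b-x+1)).filter fun z => Even (y+z+w)

/-- The solutions violating one of the bounds by `ℓ`. -/
def Bfin (m : ℕ) : Finset ((_ : ℕ) × (_ : ℕ) × (_ : ℕ) × ℕ) :=
  (range m).sigma fun k => (range (2*k+1)).sigma fun s => (Icc 1 (s/2)).sigma fun _ =>
    range (2*k-s+1)

lemma mem_Pfin (a b x w y z : ℕ) : (⟨x, w, y, z⟩ : (_ : ℕ) × (_ : ℕ) × (_ : ℕ) × ℕ) ∈ Pfin a b ↔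
    x < a+1 ∧ w < x ∧ y < a-x+1 ∧ z < b-x+1 ∧ Even (y+z+w) := by
  simp only [Pfin, mem_sigma, mem_filter, mem_range]

lemma mem_Bfin (m k s u y : ℕ) : (⟨k, s, u, y⟩ : (_ : ℕ) × (_ : ℕ) × (_ : ℕ) × ℕ) ∈ Bfin m ↔
    k < m ∧ s < 2*k+1 ∧ (1 ≤ u ∧ u ≤ s/2) ∧ y < 2*k-s+1 := by
  simp only [Bfin, mem_sigma, mem_Icc, mem_range]

lemma card_B_d (ℓ a b : ℕ) (hℓ : Even ℓ) (ha : Even a) (hb : Even b)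
    (hab : a < b) (hbl : b ≤ ℓ) (hcase : ℓ + 2 < a + b) :
    ((Pfin a b).filter fun p => ℓ + 2*p.1 + p.2.2.1 + p.2.2.2 < a + b + p.2.1).card
      = (Bfin ((a+b-ℓ)/2)).card := by
  refine Finset.card_bij'
    (fun p _ => ⟨(2*p.1-p.2.1+p.2.2.1+p.2.2.2)/2, 2*p.1-p.2.1, p.1-p.2.1, p.2.2.1⟩)
    (fun q _ => ⟨q.2.1-q.2.2.1, q.2.1-2*q.2.2.1, q.2.2.2, 2*q.1-q.2.1-q.2.2.2⟩) ?_ ?_ ?_ ?_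
  · rintro ⟨x, w, y, z⟩ h
    simp only [mem_filter, mem_Pfin, mem_Bfin, Nat.even_iff] at *
    obtain ⟨⟨h1, h2, h3, h4, h5⟩, h6⟩ := h
    obtain ⟨e, he⟩ : ∃ e, y + z + w = 2 * e := ⟨(y+z+w)/2, by omega⟩
    obtain ⟨m, hm⟩ : ∃ m, a + b = ℓ + 2 * m := ⟨(a+b-ℓ)/2, by omega⟩
    have hk : (2*x-w+y+z)/2 = x + e - w := by omega
    have hm2 : (a+b-ℓ)/2 = m := by omega
    rw [hk, hm2]
    clear hk hm2 hℓ ha hb h5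
    refine ⟨?_, ?_, ⟨?_, ?_⟩, ?_⟩ <;> omega
  · rintro ⟨k, s, u, y⟩ h
    simp only [mem_filter, mem_Pfin, mem_Bfin, Nat.even_iff] at *
    obtain ⟨h1, h2, ⟨h3, h4⟩, h5⟩ := h
    obtain ⟨m, hm⟩ : ∃ m, a + b = ℓ + 2 * m := ⟨(a+b-ℓ)/2, by omega⟩
    have hm2 : (a+b-ℓ)/2 = m := by omega
    rw [hm2] at h1
    obtain ⟨v, hv⟩ : ∃ v, s = 2*u + v := ⟨s-2*u, by omega⟩
    obtain ⟨z, hz⟩ : ∃ z, 2*k = s + y + z := ⟨2*k-s-y, by omega⟩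
    have e1 : s - u = u + v := by omega
    have e2 : s - 2*u = v := by omega
    have e3 : 2*k-s-y = z := by omega
    rw [e1, e2, e3]
    clear e1 e2 e3 hm2 hℓ ha hb
    refine ⟨⟨?_, ?_, ?_, ?_, ?_⟩, ?_⟩ <;> omega
  · rintro ⟨x, w, y, z⟩ h
    simp only [mem_filter, mem_Pfin, Nat.even_iff] at *
    simp only [Sigma.mk.injEq, heq_eq_eq, true_and, and_true]
    omega
  · rintro ⟨k, s, u, y⟩ h
    simp only [mem_Bfin] at *
    simp only [Sigma.mk.injEq, heq_eq_eq, true_and, and_true]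
    omega

lemma card_B_c (ℓ a b : ℕ) (ha : Even a) (hb : Even b)
    (hab : a < b) :
    ((Pfin a b).filter fun p => ℓ < p.2.2.1 + p.2.2.2 + p.2.1).card =
    ((Pfin a b).filter fun p => ℓ + 2*p.1 + p.2.2.1 + p.2.2.2 < a + b + p.2.1).card := by
  refine Finset.card_bij'
    (fun p _ => ⟨p.1, p.2.1, a-p.1-p.2.2.1, b-p.1-p.2.2.2⟩)
    (fun p _ => ⟨p.1, p.2.1, a-p.1-p.2.2.1, b-p.1-p.2.2.2⟩) ?_ ?_ ?_ ?_
  · rintro ⟨x, w, y, z⟩ h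
    simp only [mem_filter, mem_Pfin, Nat.even_iff] at *
    obtain ⟨⟨h1, h2, h3, h4, h5⟩, h6⟩ := h
    obtain ⟨y', hy'⟩ : ∃ y', a = x + y + y' := ⟨a-x-y, by omega⟩
    obtain ⟨z', hz'⟩ : ∃ z', b = x + z + z' := ⟨b-x-z, by omega⟩
    have e1 : a - x - y = y' := by omega
    have e2 : b - x - z = z' := by omega
    rw [e1, e2]
    clear e1 e2
    refine ⟨⟨?_, ?_, ?_, ?_, ?_⟩, ?_⟩ <;> omega
  · rintro ⟨x, w, y, z⟩ h
    simp only [mem_filter, mem_Pfin, Nat.even_iff] at *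
    obtain ⟨⟨h1, h2, h3, h4, h5⟩, h6⟩ := h
    obtain ⟨y', hy'⟩ : ∃ y', a = x + y + y' := ⟨a-x-y, by omega⟩
    obtain ⟨z', hz'⟩ : ∃ z', b = x + z + z' := ⟨b-x-z, by omega⟩
    have e1 : a - x - y = y' := by omega
    have e2 : b - x - z = z' := by omega
    rw [e1, e2]
    clear e1 e2
    refine ⟨⟨?_, ?_, ?_, ?_, ?_⟩, ?_⟩ <;> omega
  · rintro ⟨x, w, y, z⟩ h
    simp only [mem_filter, mem_Pfin, Nat.even_iff] at *
    simp only [Sigma.mk.injEq, heq_eq_eq, true_and, and_true]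
    omega
  · rintro ⟨x, w, y, z⟩ h
    simp only [mem_filter, mem_Pfin, Nat.even_iff] at *
    simp only [Sigma.mk.injEq, heq_eq_eq, true_and, and_true]
    omega

lemma Nminus_eq_card_s14 (ℓ a b : ℕ) (ha : Even a) (hb : Even b) (hab : a < b) :
    Nminus ℓ a b = ((Pfin a b).filter fun p => ¬ (ℓ < p.2.2.1 + p.2.2.2 + p.2.1) ∧
      ¬ (ℓ + 2*p.1 + p.2.2.1 + p.2.2.2 < a + b + p.2.1)).card := by
  rw [← Set.ncard_coe_finset]
  unfold Nminus
  refine Set.ncard_congr (fun p _ => ⟨p.1, p.2.2.2.2.2.1, p.2.1, p.2.2.2.1⟩) ?_ ?_ ?_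
  · rintro ⟨a12, a13, a14, a23, a24, a34, c, d⟩ h
    simp only [Set.mem_ofPred_eq, coe_filter, mem_Pfin, Nat.even_iff] at *
    omega
  · rintro ⟨a12, a13, a14, a23, a24, a34, c, d⟩ ⟨b12, b13, b14, b23, b24, b34, c', d'⟩ h h' e
    simp only [Set.mem_ofPred_eq, Sigma.mk.injEq, heq_eq_eq, Prod.mk.injEq] at *
    omega
  · rintro ⟨x, w, y, z⟩ h
    simp only [coe_filter, Set.mem_ofPred_eq, mem_Pfin, Nat.even_iff] at h
    refine ⟨(x, y, a-x-y, z, b-x-z, w, y+z+w, (a-x-y)+(b-x-z)+w), ?_, rfl⟩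
    obtain ⟨⟨h1, h2, h3, h4, h5⟩, h6, h7⟩ := h
    obtain ⟨y', hy'⟩ : ∃ y', a = x + y + y' := ⟨a-x-y, by omega⟩
    obtain ⟨z', hz'⟩ : ∃ z', b = x + z + z' := ⟨b-x-z, by omega⟩
    have e1 : a - x - y = y' := by omega
    have e2 : b - x - z = z' := by omega
    simp only [Set.mem_ofPred_eq, Nat.even_iff] at *
    rw [e1, e2]
    clear e1 e2
    refine ⟨?_, ?_, ?_, ?_, ?_, ?_, ?_, ?_, ?_⟩ <;> first | trivial | omega

lemma card_split (ℓ a b : ℕ) (hbl : b ≤ ℓ) (hab : a < b) :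
    (Pfin a b).card = ((Pfin a b).filter fun p => ¬ (ℓ < p.2.2.1 + p.2.2.2 + p.2.1) ∧
      ¬ (ℓ + 2*p.1 + p.2.2.1 + p.2.2.2 < a + b + p.2.1)).card
    + ((Pfin a b).filter fun p => ℓ < p.2.2.1 + p.2.2.2 + p.2.1).card
    + ((Pfin a b).filter fun p => ℓ + 2*p.1 + p.2.2.1 + p.2.2.2 < a + b + p.2.1).card := by
  simp only [Finset.card_filter, ← Finset.sum_add_distrib]
  rw [Finset.card_eq_sum_ones]
  refine Finset.sum_congr rfl ?_
  rintro ⟨x, w, y, z⟩ h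
  simp only [mem_Pfin] at *
  split_ifs <;> omega

lemma two_ite (n : ℕ) : (if Even n then (1:ℚ) else 0) = (1 + (-1)^n)/2 := by
  split_ifs with h
  · rw [h.neg_one_pow]; norm_num
  · rw [(Nat.not_even_iff_odd.mp h).neg_one_pow]; norm_num

lemma card_box (p q r : ℕ) (h : Even p ∨ Even q ∨ Even r) :
    (∑ w ∈ range p, ∑ y ∈ range q, (((range r).filter fun z => Even (y+z+w)).card : ℚ))
      = (p:ℚ)*q*r/2 := by
  have h1 : (∑ w ∈ range p, ∑ y ∈ range q, (((range r).filter fun z => Even (y+z+w)).card : ℚ))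
      = ((p:ℚ)*q*r + (∑ w ∈ range p, (-1:ℚ)^w) * ((∑ y ∈ range q, (-1:ℚ)^y) *
          (∑ z ∈ range r, (-1:ℚ)^z)))/2 := by
    have h2 : ∀ y w : ℕ, (((range r).filter fun z => Even (y+z+w)).card : ℚ)
        = (r + (-1)^w * ((-1)^y * ∑ z ∈ range r, (-1:ℚ)^z))/2 := by
      intro y w
      rw [Finset.card_filter]
      push_cast
      simp only [two_ite]
      rw [← Finset.sum_div, Finset.sum_add_distrib, Finset.mul_sum, Finset.mul_sum]
      simp only [sum_const, card_range, nsmul_eq_mul, mul_one]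
      congr 2
      refine Finset.sum_congr rfl fun z _ => ?_
      ring
    simp only [h2]
    simp only [← Finset.sum_div, Finset.sum_add_distrib, ← Finset.mul_sum, ← Finset.sum_mul,
      sum_const, card_range, nsmul_eq_mul]
    ring
  rw [h1, neg_one_geom_sum, neg_one_geom_sum, neg_one_geom_sum]
  rcases h with h | h | h <;> simp [h]

lemma sum_T (n : ℕ) (p q : ℚ) : ∑ x ∈ range (n+1), (x:ℚ)*(p-x)*(q-x)/2 =
    (p*q*(n*(n+1)/2) - (p+q)*(n*(n+1)*(2*n+1)/6) + (n*(n+1)/2)^2)/2 := by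
  induction n with
  | zero => simp
  | succ n ih => rw [Finset.sum_range_succ, ih]; push_cast; ring

lemma card_Pfin (a b : ℕ) (ha : Even a) (hb : Even b) (hab : a < b) :
    ((Pfin a b).card : ℚ) = ∑ x ∈ range (a+1), (x:ℚ)*((a+1:ℚ)-x)*((b+1:ℚ)-x)/2 := by
  simp only [Pfin, Finset.card_sigma]
  push_cast
  refine Finset.sum_congr rfl fun x hx => ?_
  rw [mem_range] at hx
  rw [card_box]
  · push_cast [Nat.cast_sub (show x ≤ a by omega), Nat.cast_sub (show x ≤ b by omega)]
    ring
  · simp only [Nat.even_iff] at *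
    omega

lemma sum_half (k : ℕ) (N : ℚ) : ∑ s ∈ range (2*k+1), ((s/2 : ℕ) : ℚ) * (N - s + 1) =
    (N+1) * k^2 - (k*(k+1)*(2*k+1)/3 + (k:ℚ)*(k-1)*(4*k+1)/6) := by
  induction k with
  | zero => simp
  | succ k ih =>
    rw [show 2*(k+1)+1 = 2*k+1+1+1 by ring, Finset.sum_range_succ, Finset.sum_range_succ, ih,
      show (2*k+1)/2 = k by omega, show (2*k+1+1)/2 = k+1 by omega]
    push_cast; ring

lemma sum_R1 (n : ℕ) (c : ℚ) : ∑ t ∈ Icc 1 n, (t:ℚ)*(2*(t:ℚ)-1)*c =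
    (n*(n+1)*(4*n-1)/6) * c := by
  induction n with
  | zero => simp
  | succ n ih => rw [Finset.sum_Icc_succ_top (by omega), ih]; push_cast; ring

lemma sum_R2 (n : ℕ) (c : ℚ) : ∑ t ∈ Icc 1 n, (t:ℚ)*(2*(t:ℚ)+1)*c =
    (n*(n+1)*(4*n+5)/6) * c := by
  induction n with
  | zero => simp
  | succ n ih => rw [Finset.sum_Icc_succ_top (by omega), ih]; push_cast; ring

lemma sum_R3 (n : ℕ) (c : ℚ) : ∑ t ∈ Icc 1 n, (t:ℚ)*(2*(t:ℚ)-1)*(c-2*(t:ℚ)+2) =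
    (n*(n+1)*(4*n-1)/6) * (c+2) - 2*(2*(n*(n+1)/2)^2 - n*(n+1)*(2*n+1)/6) := by
  induction n with
  | zero => simp
  | succ n ih => rw [Finset.sum_Icc_succ_top (by omega), ih]; push_cast; ring

lemma sum_R4 (n : ℕ) (c : ℚ) : ∑ t ∈ Icc 1 n, (t:ℚ)*(2*(t:ℚ)-1)*(c-(t:ℚ)) =
    (n*(n+1)*(4*n-1)/6) * c - (2*(n*(n+1)/2)^2 - n*(n+1)*(2*n+1)/6) := by
  induction n with
  | zero => simp
  | succ n ih => rw [Finset.sum_Icc_succ_top (by omega), ih]; push_cast; ring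

lemma card_Bfin (n : ℕ) : ((Bfin (n+1)).card : ℚ) =
    ∑ t ∈ Icc 1 n, (t:ℚ)*(2*(t:ℚ)-1)*(((n+1:ℕ):ℚ)-(t:ℚ)) := by
  have h : ∀ m : ℕ, ((Bfin m).card : ℚ) = ∑ k ∈ range m,
      ((2*k+1) * (k:ℚ)^2 - (k*(k+1)*(2*k+1)/3 + (k:ℚ)*(k-1)*(4*k+1)/6)) := by
    intro m
    simp only [Bfin, Finset.card_sigma]
    push_cast
    refine Finset.sum_congr rfl fun k _ => ?_
    rw [← sum_half]
    refine Finset.sum_congr rfl fun s hs => ?_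
    rw [mem_range] at hs
    simp only [card_range, sum_const, Nat.card_Icc, nsmul_eq_mul, Nat.add_sub_cancel]
    push_cast [Nat.cast_sub (show s ≤ 2*k by omega)]
    ring
  rw [h, sum_R4]
  induction n with
  | zero => simp
  | succ n ih => rw [Finset.sum_range_succ, ih]; push_cast; ring

theorem Nminus_lt_small_ell (ℓ a b : ℕ) (hℓ : Even ℓ) (ha : Even a) (hb : Even b)
    (hab : a < b) (hbl : b ≤ ℓ) (hcase : ℓ + 2 < a + b) :
    (Nminus ℓ a b : ℚ) =
      (∑ t ∈ Icc 1 (a/2), (t : ℚ) * (2*(t : ℚ) - 1) * (((b : ℚ) - a)/2 - 1)) +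
      (∑ t ∈ Icc 1 (a/2), (t : ℚ) * (2*(t : ℚ) + 1) * (((b : ℚ) - a)/2)) +
      2 * (∑ t ∈ Icc 1 (a/2), (t : ℚ) * (2*(t : ℚ) - 1) * ((a : ℚ) - 2*(t : ℚ) + 2)) -
      2 * ∑ t ∈ Icc 1 ((a + b - ℓ)/2 - 1),
            (t : ℚ) * (2*(t : ℚ) - 1) * (((a : ℚ) + b - ℓ)/2 - (t : ℚ)) := by
  have h1 := Nminus_eq_card_s14 ℓ a b ha hb hab
  have h2 := card_split ℓ a b hbl hab
  rw [← h1, card_B_c ℓ a b ha hb hab, card_B_d ℓ a b hℓ ha hb hab hbl hcase] at h2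
  have h3 := card_Pfin a b ha hb hab
  rw [h2, sum_T] at h3
  obtain ⟨n, hn⟩ : ∃ n, (a+b-ℓ)/2 = n+1 := ⟨(a+b-ℓ)/2-1, by omega⟩
  rw [hn] at h3
  push_cast [card_Bfin] at h3
  have hm : ((a:ℚ)+b-ℓ)/2 = n+1 := by
    have : a + b = ℓ + 2*(n+1) := by
      simp only [Nat.even_iff] at *
      omega
    have h' : ((a + b : ℕ):ℚ) = ((ℓ + 2*(n+1) : ℕ):ℚ) := by rw [this]
    push_cast at h'
    linarith
  rw [hn, hm, Nat.add_sub_cancel, sum_R1, sum_R2, sum_R3]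
  obtain ⟨A, rfl⟩ := ha
  rw [show (A+A)/2 = A by omega]
  push_cast at h3 ⊢
  linear_combination h3
end

section
/- Let ℓ be an even nonnegative integer and let a be an even integer with 0 ≤ a ≤ ℓ and ℓ < 2a − 2. Then N−(ℓ,a,a) = −Σ_{t=1}^{a/2} t(2t−1) + 2·Σ_{t=1}^{a/2} t(2t−1)·(a − 2t + 2) − 2·Σ_{t=1}^{(2a−ℓ)/2 − 1} t(2t−1)·((2a−ℓ)/2 − t). -/
open Finset

/-- Quadruples (k, s, x, y) with k + s < a, x, y ≤ k and x + y + s even. -/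
def NmT (a : ℕ) : Finset (Σ _ : ℕ, Σ _ : ℕ, ℕ × ℕ) :=
  (range a).sigma fun k => (range (a - k)).sigma fun s =>
    ((range (k+1)) ×ˢ (range (k+1))).filter fun p => Even (p.1 + p.2 + s)

/-- Target of the bijection that counts the excess quadruples. -/
def NmE (M : ℕ) : Finset (Σ _ : ℕ, ℕ × (Σ _ : ℕ, ℕ)) :=
  (range M).sigma fun n => (range (M - n)) ×ˢ (range (2*n+1)).sigma fun u => range (2*n+1-u)

lemma mem_NmT (a k s x y : ℕ) : (⟨k, s, x, y⟩ : Σ _ : ℕ, Σ _ : ℕ, ℕ × ℕ) ∈ NmT a ↔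
    k + s < a ∧ x ≤ k ∧ y ≤ k ∧ (x + y + s) % 2 = 0 := by
  simp only [NmT, mem_sigma, mem_filter, mem_product, mem_range, Nat.even_iff]
  omega

lemma mem_NmE (M n m u s : ℕ) : (⟨n, m, u, s⟩ : Σ _ : ℕ, ℕ × (Σ _ : ℕ, ℕ)) ∈ NmE M ↔
    n + m < M ∧ u + s ≤ 2 * n := by
  simp only [NmE, mem_sigma, mem_product, mem_range]
  omega

lemma Nminus_eq_card_s15 (ℓ a : ℕ) : Nminus ℓ a a =
    ((NmT a).filter fun q => q.2.2.1 + q.2.2.2 + q.2.1 ≤ ℓ ∧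
      2 * q.1 + q.2.1 ≤ ℓ + q.2.2.1 + q.2.2.2).card := by
  classical
  unfold Nminus
  rw [← Finset.card_image_of_injOn (f := fun q : (Σ _ : ℕ, Σ _ : ℕ, ℕ × ℕ) =>
    ((a - q.1, q.2.2.1, q.1 - q.2.2.1, q.2.2.2, q.1 - q.2.2.2, q.2.1,
      q.2.2.1 + q.2.2.2 + q.2.1, (q.1 - q.2.2.1) + (q.1 - q.2.2.2) + q.2.1) :
      ℕ × ℕ × ℕ × ℕ × ℕ × ℕ × ℕ × ℕ)), ← Set.ncard_coe_finset]
  · congr 1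
    ext ⟨p1, p2, p3, p4, p5, p6, c, d⟩
    simp only [Set.mem_ofPred_eq, coe_image, Set.mem_image, SetLike.mem_coe, mem_filter,
      Prod.mk.injEq, Nat.even_iff]
    constructor
    · rintro ⟨h1, h2, h3, h4, h5, h6, h7, h8, h9⟩
      refine ⟨⟨p2 + p3, p6, p2, p4⟩, ⟨?_, ?_⟩, ?_⟩
      · rw [mem_NmT]; omega
      · dsimp only; omega
      · dsimp only; omega
    · rintro ⟨⟨k, s, x, y⟩, ⟨h1, h2⟩, h3⟩
      rw [mem_NmT] at h1
      dsimp only at h2 h3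
      omega
  · rintro ⟨k, s, x, y⟩ h ⟨k', s', x', y'⟩ h' he
    simp only [coe_filter, Set.mem_ofPred_eq, mem_NmT] at h h'
    simp only [Prod.mk.injEq] at he
    obtain rfl : k = k' := by omega
    obtain rfl : s = s' := by omega
    obtain rfl : x = x' := by omega
    obtain rfl : y = y' := by omega
    rfl

lemma card_NmE1 (ℓ a : ℕ) (hℓ : Even ℓ) (hal : a ≤ ℓ) (hcase : ℓ + 2 < 2*a) :
    ((NmT a).filter fun q => ℓ < q.2.2.1 + q.2.2.2 + q.2.1).card =
      (NmE (a - ℓ/2 - 1)).card := by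
  rw [Nat.even_iff] at hℓ
  refine Finset.card_bij'
    (fun q _ => ⟨((q.1 - q.2.2.1) + (q.1 - q.2.2.2) + q.2.1) / 2, a - 1 - q.1 - q.2.1,
      q.1 - q.2.2.1, q.2.1⟩)
    (fun r _ => ⟨a - 1 - r.2.1 - r.2.2.2, r.2.2.2, a - 1 - r.2.1 - r.2.2.2 - r.2.2.1,
      a - 1 - r.2.1 - r.2.2.2 - (2 * r.1 - r.2.2.1 - r.2.2.2)⟩) ?_ ?_ ?_ ?_
  · rintro ⟨k, s, x, y⟩ h
    simp only [mem_filter, mem_NmT] at h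
    rw [mem_NmE]; dsimp only; omega
  · rintro ⟨n, m, u, s⟩ h
    rw [mem_NmE] at h
    rw [mem_filter, mem_NmT]; dsimp only; omega
  · rintro ⟨k, s, x, y⟩ h
    simp only [mem_filter, mem_NmT] at h
    simp only [Sigma.mk.injEq, heq_eq_eq, Prod.mk.injEq, true_and, and_true]
    omega
  · rintro ⟨n, m, u, s⟩ h
    rw [mem_NmE] at h
    simp only [Sigma.mk.injEq, heq_eq_eq, Prod.mk.injEq, true_and, and_true]
    omega

lemma card_NmE2 (ℓ a : ℕ) :
    ((NmT a).filter fun q => ℓ + q.2.2.1 + q.2.2.2 < 2 * q.1 + q.2.1).card =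
    ((NmT a).filter fun q => ℓ < q.2.2.1 + q.2.2.2 + q.2.1).card := by
  refine Finset.card_bij'
    (fun q _ => ⟨q.1, q.2.1, q.1 - q.2.2.1, q.1 - q.2.2.2⟩)
    (fun q _ => ⟨q.1, q.2.1, q.1 - q.2.2.1, q.1 - q.2.2.2⟩) ?_ ?_ ?_ ?_ <;>
  · rintro ⟨k, s, x, y⟩ h
    simp only [mem_filter, mem_NmT] at h
    simp only [mem_filter, mem_NmT, Sigma.mk.injEq, heq_eq_eq, Prod.mk.injEq, true_and, and_true]
    omega

lemma Nminus_split (ℓ a : ℕ) (hℓ : Even ℓ) (hal : a ≤ ℓ) (hcase : ℓ + 2 < 2*a) :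
    Nminus ℓ a a + 2 * (NmE (a - ℓ/2 - 1)).card = (NmT a).card := by
  have h1 := card_NmE1 ℓ a hℓ hal hcase
  have h2 := card_NmE2 ℓ a
  rw [Nminus_eq_card_s15, ← Finset.card_filter_add_card_filter_not (s := NmT a)
    (fun q => q.2.2.1 + q.2.2.2 + q.2.1 ≤ ℓ ∧ 2 * q.1 + q.2.1 ≤ ℓ + q.2.2.1 + q.2.2.2)]
  congr 1
  have hc : 2 * (NmE (a - ℓ/2 - 1)).card =
      ((NmT a).filter fun q => ℓ < q.2.2.1 + q.2.2.2 + q.2.1).card +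
      ((NmT a).filter fun q => ℓ + q.2.2.1 + q.2.2.2 < 2 * q.1 + q.2.1).card := by
    rw [h2, h1, two_mul]
  rw [hc, ← Finset.card_union_of_disjoint, ← Finset.filter_or]
  · congr 1
    apply Finset.filter_congr
    intro q _
    omega
  · rw [Finset.disjoint_left]
    rintro ⟨k, s, x, y⟩ h h'
    simp only [mem_filter, mem_NmT] at h h'
    omega

lemma sum_range_sub_Q (n : ℕ) : ∑ u ∈ range n, ((n - u : ℕ) : ℚ) = n * (n + 1) / 2 := by
  induction n with
  | zero => simp
  | succ n ih =>
    rw [Finset.sum_range_succ']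
    simp only [Nat.add_sub_add_right, ih]
    push_cast; ring

lemma card_NmE (M : ℕ) : ((NmE M).card : ℚ) =
    ∑ t ∈ Icc 1 M, (t : ℚ) * (2*(t : ℚ) - 1) * ((M : ℚ) + 1 - (t : ℚ)) := by
  rw [← Finset.Ico_add_one_right_eq_Icc, Finset.sum_Ico_eq_sum_range]
  simp only [NmE, card_sigma, card_product, card_range]
  push_cast
  refine Finset.sum_congr rfl fun n hn => ?_
  rw [mem_range] at hn
  rw [sum_range_sub_Q, Nat.cast_sub hn.le]
  push_cast; ring

lemma card_NmT (a : ℕ) (ha : Even a) : 2 * ((NmT a).card : ℚ) =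
    ∑ k ∈ range a, ((k : ℚ) + 1)^2 * ((a : ℚ) - k) := by
  simp only [NmT, card_sigma, card_filter, Finset.sum_product]
  push_cast
  rw [Finset.mul_sum]
  refine Finset.sum_congr rfl fun k hk => ?_
  rw [mem_range] at hk
  have key : ∀ s x y : ℕ, (if Even (x + y + s) then (1:ℚ) else 0) =
      (1 + (-1)^s * ((-1)^x * (-1)^y)) / 2 := by
    intro s x y
    rw [← pow_add, ← pow_add]
    split_ifs with h
    · rw [Even.neg_one_pow (by rwa [add_comm])]; norm_num
    · rw [Odd.neg_one_pow (by rw [add_comm]; simpa using h)]; norm_num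
  simp only [key, ← Finset.sum_div, Finset.sum_add_distrib, ← Finset.mul_sum, ← Finset.sum_mul,
    neg_one_geom_sum, Finset.sum_const, card_range, nsmul_eq_mul]
  rw [Nat.cast_sub hk.le]
  have : (if Even (a - k) then (0:ℚ) else 1) * 
      ((if Even (k+1) then (0:ℚ) else 1) * (if Even (k+1) then (0:ℚ) else 1)) = 0 := by
    rw [Nat.even_iff] at ha
    simp only [Nat.even_iff]
    split_ifs <;> first | omega | simp
  rw [this]
  push_cast; ring

lemma sumT (n : ℕ) (c : ℚ) : ∑ k ∈ range n, ((k : ℚ) + 1)^2 * (c - k) =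
    c * (n * (n+1) * (2*n+1) / 6) - (n * (n+1) * (n-1) * (3*n+2) / 12) := by
  induction n with
  | zero => simp
  | succ n ih => rw [Finset.sum_range_succ, ih]; push_cast; ring

lemma sumR1 (n : ℕ) : ∑ t ∈ Icc 1 n, (t : ℚ) * (2*(t : ℚ) - 1) =
    n * (n+1) * (4*n-1) / 6 := by
  induction n with
  | zero => simp
  | succ n ih => rw [Finset.sum_Icc_succ_top (by omega), ih]; push_cast; ring

lemma sumR2 (n : ℕ) (c : ℚ) : ∑ t ∈ Icc 1 n, (t : ℚ) * (2*(t : ℚ) - 1) * (c - 2*(t : ℚ) + 2) =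
    (c + 2) * (n * (n+1) * (4*n-1) / 6) - n * (n+1) * (3*n^2+n-1) / 3 := by
  induction n with
  | zero => simp
  | succ n ih => rw [Finset.sum_Icc_succ_top (by omega), ih]; push_cast; ring

theorem Nminus_eq_small_ell (ℓ a : ℕ) (hℓ : Even ℓ) (ha : Even a)
    (hal : a ≤ ℓ) (hcase : ℓ + 2 < 2*a) :
    (Nminus ℓ a a : ℚ) =
      -(∑ t ∈ Icc 1 (a/2), (t : ℚ) * (2*(t : ℚ) - 1)) +
      2 * (∑ t ∈ Icc 1 (a/2), (t : ℚ) * (2*(t : ℚ) - 1) * ((a : ℚ) - 2*(t : ℚ) + 2)) -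
      2 * ∑ t ∈ Icc 1 ((2*a - ℓ)/2 - 1),
            (t : ℚ) * (2*(t : ℚ) - 1) * ((2*(a : ℚ) - ℓ)/2 - (t : ℚ)) := by
  have h := Nminus_split ℓ a hℓ hal hcase
  have hT := card_NmT a ha
  have hE := card_NmE (a - ℓ/2 - 1)
  obtain ⟨l, rfl⟩ := hℓ
  obtain ⟨n, rfl⟩ := ha
  have e1 : (n + n) / 2 = n := by omega
  have e2 : (2 * (n + n) - (l + l)) / 2 - 1 = n + n - (l + l)/2 - 1 := by omega
  have e3 : ((n + n - (l + l)/2 - 1 : ℕ) : ℚ) + 1 = (2 * ((n + n : ℕ) : ℚ) - ((l + l : ℕ) : ℚ)) / 2 := by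
    have : (n + n - (l + l)/2 - 1) + 1 + l = n + n := by omega
    have h' : (((n + n - (l + l)/2 - 1 : ℕ) : ℚ)) + 1 + l = n + n := by exact_mod_cast this
    push_cast
    linarith
  rw [e3] at hE
  rw [e1, e2, ← hE, sumR1, sumR2]
  rw [sumT] at hT
  have h' : (Nminus (l + l) (n + n) (n + n) : ℚ) + 2 * ((NmE (n + n - (l + l)/2 - 1)).card : ℚ)
      = ((NmT (n + n)).card : ℚ) := by exact_mod_cast h
  push_cast at hT ⊢
  linear_combination h' + hT / 2
end

section
/- Let ℓ be an even nonnegative integer and let a, b be even integers with 0 ≤ a < b ≤ ℓ and ℓ ≥ a + b. Then N0(ℓ,a,b) = (1/2)·(a+1)·(a+2)·((b−a)/2 − 1) + 2·Σ_{t=1}^{a/2 + 1} t(2t−1). -/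
open Finset

/-- N0(ℓ,a,b): the number of 8-tuples (α12, α13, α14, α23, α24, α34, c, d) where c, d
are even with 0 ≤ c, d ≤ ℓ, c + d = a + b, and the α's solve the reduced system
R(a,b,c,d). -/
noncomputable def Nzero (ℓ a b : ℕ) : ℕ :=
  Set.ncard {p : ℕ × ℕ × ℕ × ℕ × ℕ × ℕ × ℕ × ℕ |
    match p with
    | (a12, a13, a14, a23, a24, a34, c, d) =>
      Even c ∧ Even d ∧ c ≤ ℓ ∧ d ≤ ℓ ∧ c + d = a + b ∧
      a12 + a13 + a14 = a ∧
      a12 + a23 + a24 = b ∧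
      a13 + a23 + a34 = c ∧
      a14 + a24 + a34 = d}

lemma card_even_aux (k n : ℕ) :
    ((range n).filter (fun j => Even (k + j))).card = if Even k then (n + 1) / 2 else n / 2 := by
  induction n with
  | zero => simp
  | succ n ih =>
    rw [range_add_one, filter_insert]
    split_ifs at ih ⊢ with h1 h2 h2 <;>
      (try rw [card_insert_of_notMem (by simp)]) <;> rw [ih] <;>
      simp only [Nat.even_iff] at * <;> omega

lemma sum_even_aux (k n p : ℕ) :
    ∑ i ∈ range (2 * p), (if Even (k + i) then (n + 1) / 2 else n / 2) = p * n := by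
  induction p with
  | zero => simp
  | succ p ih =>
    rw [show 2 * (p + 1) = 2 * p + 1 + 1 by ring, sum_range_succ, sum_range_succ, ih, add_assoc]
    have : ((if Even (k + 2 * p) then (n + 1) / 2 else n / 2)
      + if Even (k + (2 * p + 1)) then (n + 1) / 2 else n / 2) = n := by
      split_ifs <;> simp only [Nat.even_iff] at * <;> omega
    rw [this]; ring

/-- Inner count with `m = a - α12`. -/
def cnt (D m : ℕ) : ℕ :=
  ∑ i ∈ range (m + 1), ((range (m + D + 1)).filter (fun j => Even (m + i + j))).card

lemma cnt_even (q p : ℕ) : cnt (2 * q) (2 * p) = p * (2 * p + 2 * q + 1) + (p + q + 1) := by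
  unfold cnt
  simp only [card_even_aux]
  rw [sum_range_succ, sum_even_aux, if_pos (by simp)]
  omega

lemma cnt_odd (q p : ℕ) :
    cnt (2 * q) (2 * p + 1) = (p + 1) * (2 * p + 1 + 2 * q + 1) := by
  unfold cnt
  simp only [card_even_aux]
  rw [show 2 * p + 1 + 1 = 2 * (p + 1) by ring, sum_even_aux]

lemma cnt_sum (q p : ℕ) :
    ((∑ m ∈ range (2 * p + 1), cnt (2 * q) m : ℕ) : ℚ) =
      (1/2) * (2 * p + 1) * (2 * p + 2) * (q - 1) +
      2 * ∑ t ∈ Icc 1 (p + 1), (t : ℚ) * (2*(t : ℚ) - 1) := by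
  induction p with
  | zero =>
    have := cnt_even q 0
    simp at this
    simp [this]; ring
  | succ p ih =>
    rw [show 2 * (p + 1) + 1 = 2 * p + 1 + 1 + 1 by ring, sum_range_succ, sum_range_succ,
      Nat.cast_add, Nat.cast_add, ih, cnt_odd, show 2 * p + 1 + 1 = 2 * (p + 1) by ring, cnt_even,
      sum_Icc_succ_top (b := p + 1) (by omega)]
    push_cast
    ring

lemma Nzero_eq (ℓ a b : ℕ) (ha : Even a) (hb : Even b)
    (hab : a < b) (hcase : a + b ≤ ℓ) :
    Nzero ℓ a b = ∑ m ∈ range (a + 1), cnt (b - a) m := by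
  let S : Finset ((_ : ℕ) × (_ : ℕ) × ℕ) :=
    (range (a + 1)).sigma fun m => (range (m + 1)).sigma fun i =>
      (range (m + (b - a) + 1)).filter (fun j => Even (m + i + j))
  have hS : S.card = ∑ m ∈ range (a + 1), cnt (b - a) m := by
    simp only [S, card_sigma, cnt]
  let f : ((_ : ℕ) × (_ : ℕ) × ℕ) → ℕ × ℕ × ℕ × ℕ × ℕ × ℕ × ℕ × ℕ := fun s =>
    (a - s.1, s.2.1, s.1 - s.2.1, s.2.2, s.1 + (b - a) - s.2.2, a - s.1,
      s.2.1 + s.2.2 + (a - s.1), a + b - (s.2.1 + s.2.2 + (a - s.1)))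
  rw [← hS, ← Set.ncard_coe_finset, Nzero, ← Set.ncard_image_of_injOn (f := f) (s := (S : Set _))]
  · congr 1
    ext ⟨a12, a13, a14, a23, a24, a34, c, d⟩
    simp only [Set.mem_setOf_eq, Set.mem_image, f, S, mem_coe, mem_sigma, mem_range, mem_filter,
      Prod.mk.injEq, Nat.even_iff] at *
    constructor
    · rintro ⟨h1, h2, h3, h4, h5, h6, h7, h8, h9⟩
      refine ⟨⟨a - a12, a13, a23⟩, ?_, ?_⟩ <;> dsimp only <;> omega
    · rintro ⟨⟨m, i, j⟩, h, h'⟩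
      dsimp only at h h'
      omega
  · rintro ⟨m, i, j⟩ h ⟨m', i', j'⟩ h' e
    simp only [f, S, mem_coe, mem_sigma, mem_range, mem_filter, Prod.mk.injEq] at h h' e
    obtain rfl : m = m' := by omega
    obtain rfl : i = i' := by omega
    obtain rfl : j = j' := by omega
    rfl

theorem Nzero_lt_large_ell (ℓ a b : ℕ) (hℓ : Even ℓ) (ha : Even a) (hb : Even b)
    (hab : a < b) (hbl : b ≤ ℓ) (hcase : a + b ≤ ℓ) :
    (Nzero ℓ a b : ℚ) =
      (1/2) * ((a : ℚ) + 1) * ((a : ℚ) + 2) * (((b : ℚ) - a)/2 - 1) +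
      2 * ∑ t ∈ Icc 1 (a/2 + 1), (t : ℚ) * (2*(t : ℚ) - 1) := by
  rw [Nzero_eq ℓ a b ha hb hab hcase]
  obtain ⟨p, rfl⟩ := ha.two_dvd
  obtain ⟨r, rfl⟩ := hb.two_dvd
  obtain ⟨q, rfl⟩ : ∃ q, r = p + q := ⟨r - p, by omega⟩
  rw [show 2 * (p + q) - 2 * p = 2 * q by omega, cnt_sum, show 2 * p / 2 = p by omega]
  push_cast
  ring
end

section
/- Let ℓ be an even nonnegative integer and let a be an even integer with 0 ≤ a ≤ ℓ and ℓ ≥ 2a. Then N0(ℓ,a,a) = −(1/2)·(a+1)·(a+2) + 2·Σ_{t=1}^{a/2 + 1} t(2t−1). -/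
open Finset

lemma card_parity (m : ℕ) :
    ((((range (m+1)) ×ˢ (range (m+1))).filter (fun q => Even (q.1 + q.2 + m))).card : ℚ)
      = (((m:ℚ)+1)^2 + (if Even m then 1 else 0)) / 2 := by
  have h1 : ∀ n : ℕ, (if Even n then (1:ℚ) else 0) = (1 + (-1)^n) / 2 := by
    intro n
    by_cases h : Even n
    · simp [h, h.neg_one_pow]
    · simp [h, (Nat.not_even_iff_odd.mp h).neg_one_pow]
  rw [card_filter]
  push_cast
  simp_rw [h1]
  rw [← sum_div, sum_add_distrib, sum_product, sum_product]
  simp_rw [pow_add, ← sum_mul, ← sum_mul_sum, neg_one_geom_sum]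
  by_cases h : Even m
  · simp [h, h.neg_one_pow, Nat.even_add_one]; ring
  · simp [h, (Nat.not_even_iff_odd.mp h).neg_one_pow, Nat.even_add_one]; ring

lemma Nzero_card (ℓ a : ℕ) (ha : Even a) (hcase : 2*a ≤ ℓ) :
    Nzero ℓ a a = ∑ m ∈ range (a+1),
      (((range (m+1)) ×ˢ (range (m+1))).filter (fun q => Even (q.1 + q.2 + m))).card := by
  rw [← card_sigma, ← Set.ncard_coe_finset]
  unfold Nzero
  symm
  refine Set.ncard_congr (fun s _ => (a - s.1, s.2.1, s.1 - s.2.1, s.2.2, s.1 - s.2.2, a - s.1,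
    s.2.1 + s.2.2 + (a - s.1), (s.1 - s.2.1) + (s.1 - s.2.2) + (a - s.1))) ?_ ?_ ?_
  · rintro ⟨m, x, y⟩ h
    simp only [coe_sigma, Set.mem_sigma_iff, mem_coe, mem_range, mem_filter, mem_product] at h
    simp only [Set.mem_ofPred_eq]
    simp only [Nat.even_iff] at *
    repeat' apply And.intro
    all_goals first | trivial | omega
  · rintro ⟨m, x, y⟩ ⟨m2, x2, y2⟩ h h2 e
    simp only [coe_sigma, Set.mem_sigma_iff, mem_coe, mem_range, mem_filter, mem_product] at h h2
    simp only [Prod.mk.injEq] at e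
    obtain rfl : m = m2 := by omega
    obtain rfl : x = x2 := by omega
    obtain rfl : y = y2 := by omega
    rfl
  · rintro ⟨a12, a13, a14, a23, a24, a34, c, d⟩ h
    simp only [Set.mem_ofPred_eq] at h
    refine ⟨⟨a13 + a14, a13, a23⟩, ?_, ?_⟩
    · simp only [coe_sigma, Set.mem_sigma_iff, mem_coe, mem_range, mem_filter, mem_product]
      simp only [Nat.even_iff] at *
      repeat' apply And.intro
      all_goals first | trivial | omega
    · simp only [Prod.mk.injEq]
      repeat' apply And.intro
      all_goals first | trivial | omega

theorem Nzero_eq_large_ell (ℓ a : ℕ) (hℓ : Even ℓ) (ha : Even a)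
    (hal : a ≤ ℓ) (hcase : 2*a ≤ ℓ) :
    (Nzero ℓ a a : ℚ) =
      -((1/2) * ((a : ℚ) + 1) * ((a : ℚ) + 2)) +
      2 * ∑ t ∈ Icc 1 (a/2 + 1), (t : ℚ) * (2*(t : ℚ) - 1) := by
  rw [Nzero_card ℓ a ha hcase]
  push_cast
  simp_rw [card_parity]
  obtain ⟨k, rfl⟩ := ha
  clear hℓ hal hcase
  have e : (k + k) / 2 = k := by omega
  rw [e]
  clear e
  induction k with
  | zero => norm_num
  | succ k ih =>
    rw [show k + 1 + (k + 1) + 1 = (k + k + 1) + 1 + 1 by ring, sum_range_succ, sum_range_succ, ih,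
      sum_Icc_succ_top (by omega : 1 ≤ k + 1 + 1)]
    have h1 : ¬ Even (k + k + 1) := by simp [Nat.even_add_one]
    have h2 : Even (k + k + 1 + 1) := by simp [Nat.even_add_one]
    rw [if_neg h1, if_pos h2]
    push_cast
    ring
end

section
/- Let ℓ be an even nonnegative integer and let a, b be even integers with 0 ≤ a < b ≤ ℓ and ℓ < a + b. Then N0(ℓ,a,b) = (1/2)·(a+1)·(a+2)·((b−a)/2 − 1) + 2·Σ_{t=1}^{(ℓ−b)/2 + 1} (1/2)·(a+b−ℓ+2t−1)·(a+b−ℓ+2t). -/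
open Finset

/-- index set for the solutions: `k` is half of `c` (shifted by `g`), then `n ≤ m` and a pair with sum `n`. -/
def idxF (N : ℕ) (m : ℕ → ℕ) : Finset (ℕ × ℕ × ℕ) :=
  (range N).biUnion fun k => (range (m k + 1)).biUnion fun n =>
    (antidiagonal n).image fun q => (k, q.1, q.2)

lemma mem_idxF (N : ℕ) (m : ℕ → ℕ) (k x z : ℕ) :
    (k, x, z) ∈ idxF N m ↔ k < N ∧ x + z ≤ m k := by
  simp only [idxF, mem_biUnion, mem_range, mem_image, HasAntidiagonal.mem_antidiagonal, Prod.mk.injEq, Prod.exists]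
  constructor
  · rintro ⟨k', hk, n, hn, x', z', hs, rfl, rfl, rfl⟩
    exact ⟨hk, by omega⟩
  · rintro ⟨hk, h⟩
    exact ⟨k, hk, x + z, by omega, x, z, rfl, rfl, rfl, rfl⟩

lemma card_idxF (N : ℕ) (m : ℕ → ℕ) :
    ((idxF N m).card : ℚ) = ∑ k ∈ range N, (1/2) * ((m k : ℚ) + 1) * ((m k : ℚ) + 2) := by
  unfold idxF
  rw [card_biUnion]
  · push_cast
    refine sum_congr rfl fun k _ => ?_
    rw [card_biUnion]
    · have : ∀ n ∈ range (m k + 1),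
          ((antidiagonal n).image fun q => (k, q.1, q.2)).card = n + 1 := by
        intro n _
        rw [card_image_of_injective, Nat.card_antidiagonal]
        rintro ⟨_, _⟩ ⟨_, _⟩ h
        simpa using h
      rw [sum_congr rfl this]
      push_cast
      induction m k with
      | zero => norm_num
      | succ j ih => rw [sum_range_succ, ih]; push_cast; ring
    · intro i _ j _ hij
      simp only [disjoint_left, mem_image, HasAntidiagonal.mem_antidiagonal, not_exists, not_and]
      rintro _ ⟨⟨x, y⟩, h1, rfl⟩ ⟨x', y'⟩ h2 h3
      simp only [Prod.mk.injEq] at h3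
      simp only at h1 h2
      omega
  · intro i _ j _ hij
    simp only [disjoint_left, mem_biUnion, mem_image, not_exists, not_and]
    rintro _ ⟨n, _, ⟨x, y⟩, h1, rfl⟩ n' _ ⟨x', y'⟩ h2 h3
    simp only [Prod.mk.injEq] at h3
    omega

lemma Nzero_eq_card (e f g : ℕ) :
    Nzero (2 * (f + g + 1 + e + f)) (2 * (f + g)) (2 * (f + g + 1 + e)) =
      (idxF ((f + 1) + e + (f + 1)) fun k =>
        min (2 * (f + g)) (min (2 * (g + k)) (2 * (2 * f + g + 1 + e - k)))).card := by
  classical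
  set b := 2 * (f + g + 1 + e) with hb
  set a := 2 * (f + g) with ha
  set F : ℕ × ℕ × ℕ → ℕ × ℕ × ℕ × ℕ × ℕ × ℕ × ℕ × ℕ := fun p =>
    (p.2.1, p.2.2 + (2 * (g + p.1) - b), a - p.2.1 - (p.2.2 + (2 * (g + p.1) - b)),
      2 * (g + p.1) - p.2.1 - (p.2.2 + (2 * (g + p.1) - b)),
      b + (p.2.2 + (2 * (g + p.1) - b)) - 2 * (g + p.1), p.2.1, 2 * (g + p.1),
      a + b - 2 * (g + p.1)) with hF
  rw [← card_image_of_injective (f := F), ← Set.ncard_coe_finset]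
  · unfold Nzero
    congr 1
    ext ⟨a12, a13, a14, a23, a24, a34, c, d⟩
    simp only [Set.mem_ofPred_eq, coe_image, Set.mem_image, mem_coe, Prod.exists, mem_idxF, hF,
      Prod.mk.injEq]
    constructor
    · rintro ⟨⟨c', hc⟩, ⟨d', hd⟩, h1, h2, h3, h4, h5, h6, h7⟩
      refine ⟨c' - g, a12, a13 - (c - b), ?_⟩
      have : 2 * (g + (c' - g)) = c := by omega
      rw [this]
      omega
    · rintro ⟨k, x, z, ⟨h1, h2⟩, rfl, rfl, rfl, rfl, rfl, rfl, rfl, rfl⟩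
      refine ⟨⟨g + k, by omega⟩, ⟨2 * f + g + 1 + e - k, by omega⟩, ?_⟩
      omega
  · rintro ⟨k, x, z⟩ ⟨k', x', z'⟩ h
    simp only [hF, Prod.mk.injEq] at h
    obtain ⟨h1, h2, -, -, -, -, h3, -⟩ := h
    have : k = k' := by omega
    subst this
    obtain rfl : x = x' := h1
    obtain rfl : z = z' := Nat.add_right_cancel h2
    rfl

theorem Nzero_lt_small_ell (ℓ a b : ℕ) (hℓ : Even ℓ) (ha : Even a) (hb : Even b)
    (hab : a < b) (hbl : b ≤ ℓ) (hcase : ℓ < a + b) :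
    (Nzero ℓ a b : ℚ) =
      (1/2) * ((a : ℚ) + 1) * ((a : ℚ) + 2) * (((b : ℚ) - a)/2 - 1) +
      2 * ∑ t ∈ Icc 1 ((ℓ - b)/2 + 1),
            (1/2) * ((a : ℚ) + b - ℓ + 2*(t : ℚ) - 1) * ((a : ℚ) + b - ℓ + 2*(t : ℚ)) := by
  obtain ⟨L, rfl⟩ := hℓ
  obtain ⟨A, rfl⟩ := ha
  obtain ⟨B, rfl⟩ := hb
  obtain ⟨e, rfl⟩ : ∃ e, B = A + 1 + e := ⟨B - A - 1, by omega⟩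
  obtain ⟨f, rfl⟩ : ∃ f, L = A + 1 + e + f := ⟨L - (A + 1 + e), by omega⟩
  obtain ⟨g, rfl⟩ : ∃ g, A = f + g := ⟨A - f, by omega⟩
  simp only [← two_mul]
  rw [Nzero_eq_card, card_idxF, sum_range_add, sum_range_add]
  have h0 : (2 * (f + g + 1 + e + f) - 2 * (f + g + 1 + e)) / 2 + 1 = f + 1 := by omega
  rw [h0]
  have hS : ∑ t ∈ Icc 1 (f + 1), (1/2) * (((2 * (f + g) : ℕ) : ℚ) + (2 * (f + g + 1 + e) : ℕ)
        - (2 * (f + g + 1 + e + f) : ℕ) + 2*(t : ℚ) - 1) * (((2 * (f + g) : ℕ) : ℚ)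
        + (2 * (f + g + 1 + e) : ℕ) - (2 * (f + g + 1 + e + f) : ℕ) + 2*(t : ℚ))
      = ∑ k ∈ range (f + 1), (1/2) * (((2 * (g + k) : ℕ) : ℚ) + 1) * (((2 * (g + k) : ℕ) : ℚ) + 2) := by
    rw [← Finset.Ico_add_one_right_eq_Icc, sum_Ico_eq_sum_range]
    refine sum_congr (by simp) fun k _ => ?_
    push_cast
    ring
  rw [hS]
  have h1 : ∀ k ∈ range (f + 1), min (2 * (f + g)) (min (2 * (g + k)) (2 * (2 * f + g + 1 + e - k)))
      = 2 * (g + k) := by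
    intro k hk
    rw [mem_range] at hk
    omega
  have h2 : ∀ k ∈ range e, min (2 * (f + g)) (min (2 * (g + (f + 1 + k)))
      (2 * (2 * f + g + 1 + e - (f + 1 + k)))) = 2 * (f + g) := by
    intro k hk
    rw [mem_range] at hk
    omega
  have h3 : ∀ k ∈ range (f + 1), min (2 * (f + g)) (min (2 * (g + (f + 1 + e + k)))
      (2 * (2 * f + g + 1 + e - (f + 1 + e + k)))) = 2 * (g + (f + 1 - 1 - k)) := by
    intro k hk
    rw [mem_range] at hk
    omega
  refine (congrArg₂ (· + ·) (congrArg₂ (· + ·)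
    (sum_congr rfl fun k hk => by rw [h1 k hk])
    (sum_congr rfl fun k hk => by rw [h2 k hk]))
    (sum_congr rfl fun k hk => by rw [h3 k hk])).trans ?_
  have hr := sum_range_reflect (fun k : ℕ =>
    (1/2) * (((2 * (g + k) : ℕ) : ℚ) + 1) * (((2 * (g + k) : ℕ) : ℚ) + 2)) (f + 1)
  beta_reduce at hr ⊢
  rw [hr, sum_const, card_range, nsmul_eq_mul]
  push_cast
  ring
end

section
/- Let ℓ be an even nonnegative integer and let a be an even integer with 0 ≤ a ≤ ℓ and ℓ < 2a. Then N0(ℓ,a,a) = −(1/2)·(a+1)·(a+2) + 2·Σ_{t=1}^{(ℓ−a)/2 + 1} (1/2)·(2a−ℓ+2t−1)·(2a−ℓ+2t). -/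
open Finset

/-- Triangle of pairs `(k,i)` with `k + i ≤ c`. -/
def triSet (c : ℕ) : Finset (Σ _ : ℕ, ℕ) := (range (c+1)).sigma fun k => range (c+1-k)

theorem mem_triSet (c k i : ℕ) : (⟨k, i⟩ : Σ _ : ℕ, ℕ) ∈ triSet c ↔ k + i ≤ c := by
  simp only [triSet, mem_sigma, mem_range]
  omega

theorem card_triSet (c : ℕ) : ((triSet c).card : ℚ) = (1/2) * ((c:ℚ)+1) * ((c:ℚ)+2) := by
  have h : (triSet c).card = ∑ k ∈ range (c+1), (k+1) := by
    rw [triSet, card_sigma, ← Finset.sum_range_reflect]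
    refine Finset.sum_congr rfl fun k hk => ?_
    rw [mem_range] at hk
    rw [card_range]
    omega
  rw [h]
  push_cast
  clear h
  induction c with
  | zero => norm_num
  | succ c ih => rw [Finset.sum_range_succ, ih]; push_cast; ring

/-- Union of triangles of sizes `e + 2u`, `u < n`. -/
def bigSet (e n : ℕ) : Finset (Σ _ : ℕ, Σ _ : ℕ, ℕ) :=
  (range n).sigma fun u => triSet (e + 2*u)

theorem mem_bigSet (e n u k i : ℕ) :
    (⟨u, k, i⟩ : Σ _ : ℕ, Σ _ : ℕ, ℕ) ∈ bigSet e n ↔ u < n ∧ k + i ≤ e + 2*u := by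
  simp only [bigSet, mem_sigma, mem_range, mem_triSet]

theorem card_bigSet (e n : ℕ) : ((bigSet e n).card : ℚ) =
    ∑ u ∈ range n, (1/2) * ((e:ℚ)+2*u+1) * ((e:ℚ)+2*u+2) := by
  rw [bigSet, card_sigma]
  push_cast
  refine Finset.sum_congr rfl fun u _ => ?_
  rw [card_triSet]
  push_cast
  rfl

/-- Parametrization of solutions with `c ≤ a`. -/
def mapA (e a : ℕ) (x : Σ _ : ℕ, Σ _ : ℕ, ℕ) : ℕ × ℕ × ℕ × ℕ × ℕ × ℕ × ℕ × ℕ :=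
  (x.2.1, x.2.2, a - x.2.1 - x.2.2, e + 2*x.1 - x.2.1 - x.2.2, a - (e + 2*x.1) + x.2.2,
    x.2.1, e + 2*x.1, 2*a - (e + 2*x.1))

/-- Parametrization of solutions with `d ≤ a`. -/
def mapB (e a : ℕ) (x : Σ _ : ℕ, Σ _ : ℕ, ℕ) : ℕ × ℕ × ℕ × ℕ × ℕ × ℕ × ℕ × ℕ :=
  (x.2.1, a - x.2.1 - x.2.2, x.2.2, a - (e + 2*x.1) + x.2.2, e + 2*x.1 - x.2.1 - x.2.2,
    x.2.1, 2*a - (e + 2*x.1), e + 2*x.1)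

theorem mapA_inj (e a : ℕ) : Function.Injective (mapA e a) := by
  rintro ⟨u, k, i⟩ ⟨u', k', i'⟩ h
  simp only [mapA, Prod.mk.injEq] at h
  obtain ⟨h1, h2, -, -, -, -, h3, -⟩ := h
  obtain rfl : u = u' := by omega
  subst h1 h2
  rfl

theorem mapB_inj (e a : ℕ) : Function.Injective (mapB e a) := by
  rintro ⟨u, k, i⟩ ⟨u', k', i'⟩ h
  simp only [mapB, Prod.mk.injEq] at h
  obtain ⟨h1, -, h2, -, -, -, -, h3⟩ := h
  obtain rfl : u = u' := by omega
  subst h1 h2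
  rfl

theorem Nzero_card_s19 (e n : ℕ) (he : Even e) :
    Nzero (e + 2*n + 2*n) (e + 2*n) (e + 2*n) = (bigSet e (n+1)).card + (bigSet e n).card := by
  classical
  have hd : Disjoint ((bigSet e (n+1)).image (mapA e (e+2*n)))
      ((bigSet e n).image (mapB e (e+2*n))) := by
    rw [Finset.disjoint_left]
    intro p hp hq
    rw [mem_image] at hp hq
    obtain ⟨⟨u, k, i⟩, hx, rfl⟩ := hp
    obtain ⟨⟨u', k', i'⟩, hy, h⟩ := hq
    rw [mem_bigSet] at hx hy
    simp only [mapA, mapB, Prod.mk.injEq] at h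
    omega
  rw [← Finset.card_image_of_injective (bigSet e (n+1)) (mapA_inj e (e+2*n)),
    ← Finset.card_image_of_injective (bigSet e n) (mapB_inj e (e+2*n)),
    ← Finset.card_union_of_disjoint hd, ← Set.ncard_coe_finset, Nzero]
  congr 1
  ext ⟨a12, a13, a14, a23, a24, a34, c, d⟩
  obtain ⟨f, rfl⟩ := he
  simp only [Set.mem_ofPred_eq, Finset.mem_coe, mem_union, mem_image]
  constructor
  · rintro ⟨⟨c', rfl⟩, ⟨d', rfl⟩, h1, h2, h3, h4, h5, h6, h7⟩
    by_cases hc : c' ≤ f + n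
    · left
      refine ⟨⟨c' - f, a12, a13⟩, ?_, ?_⟩
      · rw [mem_bigSet]; omega
      · simp only [mapA, Prod.mk.injEq]
        refine ⟨?_, ?_, ?_, ?_, ?_, ?_, ?_, ?_⟩ <;> first | trivial | omega
    · right
      refine ⟨⟨d' - f, a12, a14⟩, ?_, ?_⟩
      · rw [mem_bigSet]; omega
      · simp only [mapB, Prod.mk.injEq]
        refine ⟨?_, ?_, ?_, ?_, ?_, ?_, ?_, ?_⟩ <;> first | trivial | omega
  · rintro (⟨⟨u, k, i⟩, hx, h⟩ | ⟨⟨u, k, i⟩, hx, h⟩)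
    · rw [mem_bigSet] at hx
      simp only [mapA, Prod.mk.injEq] at h
      simp only [Nat.even_iff]
      omega
    · rw [mem_bigSet] at hx
      simp only [mapB, Prod.mk.injEq] at h
      simp only [Nat.even_iff]
      omega

theorem Nzero_eq_small_ell (ℓ a : ℕ) (hℓ : Even ℓ) (ha : Even a)
    (hal : a ≤ ℓ) (hcase : ℓ < 2*a) :
    (Nzero ℓ a a : ℚ) =
      -((1/2) * ((a : ℚ) + 1) * ((a : ℚ) + 2)) +
      2 * ∑ t ∈ Icc 1 ((ℓ - a)/2 + 1),
            (1/2) * (2*(a : ℚ) - ℓ + 2*(t : ℚ) - 1) * (2*(a : ℚ) - ℓ + 2*(t : ℚ)) := by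
  obtain ⟨e, n, he, rfl, rfl⟩ : ∃ e n, Even e ∧ a = e + 2*n ∧ ℓ = e + 2*n + 2*n := by
    obtain ⟨m, rfl⟩ := hℓ
    obtain ⟨b, rfl⟩ := ha
    exact ⟨2*(2*b-m), m-b, even_two_mul _, by omega, by omega⟩
  have hn : (e + 2*n + 2*n - (e + 2*n))/2 + 1 = n + 1 := by omega
  rw [hn, Nzero_card_s19 e n he]
  have hI : ∀ g : ℕ → ℚ, ∑ t ∈ Icc 1 (n+1), g t = ∑ u ∈ range (n+1), g (u+1) := by
    intro g
    rw [Finset.range_eq_Ico, Finset.sum_Ico_add' g 0 (n+1) 1]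
    rfl
  rw [hI]
  push_cast
  rw [card_bigSet, card_bigSet]
  have hS : ∀ u ∈ range (n+1), (1/2) * (2*((e:ℚ)+2*n) - (e+2*n+2*n) + 2*((u:ℚ)+1) - 1) *
      (2*((e:ℚ)+2*n) - (e+2*n+2*n) + 2*((u:ℚ)+1)) =
      (1/2) * ((e:ℚ)+2*u+1) * ((e:ℚ)+2*u+2) := by
    intro u _
    ring
  rw [Finset.sum_congr rfl hS, Finset.sum_range_succ]
  ring
end
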